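/- Let 𝒫 be a Beurling generalized prime system, ρ > 0, and α, β ∈ [0,1) such that for every ε > 0, ψ_𝒫(x) = x + O(x^{α+ε}) and N_𝒫(x) = ρx + O(x^{β+ε}) as x → ∞. Then for every ε > 0, M_𝒫(x) = O(x^{Θ+ε}) as x → ∞, where Θ = max{α, β}. -/

import Mathlib

open Filter Asymptotics

/-- ψ_𝒫(x): sum of log pᵢ over pairs (i,k) with k ≥ 1 and pᵢ^k ≤ x. -/
noncomputable def psiP (p : ℕ → ℝ) (x : ℝ) : ℝ :=
  ∑ᶠ ik ∈ {ik : ℕ × ℕ | 1 ≤ ik.2 ∧ p ik.1 ^ ik.2 ≤ x}, Real.log (p ik.1)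

/-- N_𝒫(x): number of finitely supported e : ℕ → ℕ with ∏ pᵢ^{e i} ≤ x. -/
noncomputable def NP (p : ℕ → ℝ) (x : ℝ) : ℕ :=
  Nat.card {e : ℕ →₀ ℕ | ∏ i ∈ e.support, p i ^ e i ≤ x}

/-- M_𝒫(x): sum of (−1)^|S| over finite S ⊆ ℕ with ∏_{i∈S} pᵢ ≤ x. -/
noncomputable def MP (p : ℕ → ℝ) (x : ℝ) : ℝ :=
  ∑ᶠ S ∈ {S : Finset ℕ | ∏ i ∈ S, p i ≤ x}, (-1 : ℝ) ^ S.card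

namespace BeurlingAux
open Complex MeasureTheory Set Filter Topology Asymptotics

/-- weighted counting function -/
noncomputable def cnt {ι : Type*} (a w : ι → ℝ) (x : ℝ) : ℝ := ∑ᶠ i ∈ {i | a i ≤ x}, w i

variable {ι : Type*} {a w : ι → ℝ}

lemma cnt_hasSum (hfin : ∀ x, {i | a i ≤ x}.Finite) (x : ℝ) :
    HasSum (fun i => (Ici (a i)).indicator (fun _ => w i) x) (cnt a w x) := by
  have h1 : cnt a w x = ∑ i ∈ (hfin x).toFinset, (Ici (a i)).indicator (fun _ => w i) x := by
    rw [cnt, finsum_mem_eq_finite_toFinset_sum _ (hfin x)]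
    apply Finset.sum_congr rfl
    intro i hi
    have : a i ≤ x := by simpa using hi
    simp [indicator, this]
  rw [h1]
  apply hasSum_sum_of_ne_finset_zero
  intro i hi
  have : ¬ a i ≤ x := by simpa using hi
  simp [indicator, this]

lemma cnt_mono (hw : ∀ i, 0 ≤ w i) (hfin : ∀ x, {i | a i ≤ x}.Finite) : Monotone (cnt a w) := by
  intro x y hxy
  apply hasSum_le _ (cnt_hasSum hfin x) (cnt_hasSum hfin y)
  intro i
  by_cases h : a i ≤ x
  · have := h.trans hxy
    simp [indicator, h, this]
  · by_cases h' : a i ≤ y <;> simp [indicator, h, h', hw i]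

lemma cnt_zero (ha : ∀ i, 1 ≤ a i) {x : ℝ} (hx : x < 1) : cnt a w x = 0 := by
  have : {i | a i ≤ x} = ∅ := by
    ext i; simp; exact lt_of_lt_of_le hx (ha i)
  simp [cnt, this]

lemma sum_le_cnt (hw : ∀ i, 0 ≤ w i) (hfin : ∀ x, {i | a i ≤ x}.Finite) (T : Finset ι) (x : ℝ) :
    ∑ i ∈ T, (Ici (a i)).indicator (fun _ => w i) x ≤ cnt a w x :=
  sum_le_hasSum T (fun i _ => indicator_nonneg (fun _ _ => hw i) _) (cnt_hasSum hfin x)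

lemma term_real {b σ : ℝ} (hb : 1 ≤ b) (hσ : 0 < σ) (v : ℝ) :
    IntegrableOn (fun x : ℝ => x ^ (-σ - 1) * (Ici b).indicator (fun _ => v) x) (Ioi 0) ∧
    ∫ x in Ioi (0:ℝ), x ^ (-σ - 1) * (Ici b).indicator (fun _ => v) x = v * b ^ (-σ) / σ := by
  have e : (fun x : ℝ => x ^ (-σ - 1) * (Ici b).indicator (fun _ => v) x) =
      (Ici b).indicator (fun x => x ^ (-σ - 1) * v) := by
    ext x; by_cases h : b ≤ x <;> simp [indicator, h]
  have hs : Ioi (0:ℝ) ∩ Ici b = Ici b := by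
    apply inter_eq_right.mpr; intro x hx; simp at *; linarith
  constructor
  · rw [e, IntegrableOn, integrable_indicator_iff measurableSet_Ici, IntegrableOn,
      Measure.restrict_restrict measurableSet_Ici, inter_comm, hs]
    have := integrableOn_Ioi_rpow_of_lt (a := -σ - 1) (by linarith) (c := b) (by linarith)
    exact ((integrableOn_Ici_iff_integrableOn_Ioi).mpr this).mul_const v
  · rw [e, setIntegral_indicator measurableSet_Ici, hs, integral_Ici_eq_integral_Ioi,
      integral_mul_const, integral_Ioi_rpow_of_lt (by linarith) (by linarith)]
    rw [show -σ - 1 + 1 = -σ by ring]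
    field_simp

lemma term_complex {b : ℝ} {s : ℂ} (hb : 1 ≤ b) (hs : 0 < s.re) (v : ℝ) :
    IntegrableOn (fun x : ℝ => (x : ℂ) ^ (-s - 1) * ((Ici b).indicator (fun _ => v) x : ℝ))
      (Ioi 0) ∧
    ∫ x in Ioi (0:ℝ), (x : ℂ) ^ (-s - 1) * ((Ici b).indicator (fun _ => v) x : ℝ) =
      v * (b : ℂ) ^ (-s) / s := by
  have hs0 : s ≠ 0 := by rintro rfl; simp at hs
  have e : (fun x : ℝ => (x : ℂ) ^ (-s - 1) * ((Ici b).indicator (fun _ => v) x : ℝ)) =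
      (Ici b).indicator (fun x : ℝ => (x : ℂ) ^ (-s - 1) * v) := by
    ext x; by_cases h : b ≤ x <;> simp [indicator, h]
  have hss : Ioi (0:ℝ) ∩ Ici b = Ici b := by
    apply inter_eq_right.mpr; intro x hx; simp at *; linarith
  constructor
  · rw [e, IntegrableOn, integrable_indicator_iff measurableSet_Ici, IntegrableOn,
      Measure.restrict_restrict measurableSet_Ici, inter_comm, hss]
    have := integrableOn_Ioi_cpow_of_lt (a := -s - 1) (by simp; linarith) (c := b) (by linarith)
    exact ((integrableOn_Ici_iff_integrableOn_Ioi).mpr this).mul_const _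
  · rw [e, setIntegral_indicator measurableSet_Ici, hss, integral_Ici_eq_integral_Ioi,
      integral_mul_const, integral_Ioi_cpow_of_lt (by simp; linarith) (by linarith)]
    rw [show -s - 1 + 1 = -s by ring]
    field_simp

lemma dirichlet_summable (ha : ∀ i, 1 ≤ a i) (hw : ∀ i, 0 ≤ w i)
    (hfin : ∀ x, {i | a i ≤ x}.Finite) {C : ℝ}
    (hC : ∀ x, 1 ≤ x → cnt a w x ≤ C * x) {σ : ℝ} (hσ : 1 < σ) :
    Summable (fun i => w i * a i ^ (-σ)) := by
  have h0 : ∀ i, 0 ≤ w i * a i ^ (-σ) / σ := fun i => by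
    have := ha i; have := hw i; positivity
  have : Summable (fun i => w i * a i ^ (-σ) / σ) := by
    apply summable_of_sum_le (c := C * (1:ℝ) ^ (-(σ - 1)) / (σ - 1)) h0
    intro T
    rw [← (term_real (b := 1) (σ := σ - 1) le_rfl (by linarith) C).2]
    have hi := (term_real (b := 1) (σ := σ - 1) le_rfl (by linarith) C).1
    calc ∑ i ∈ T, w i * a i ^ (-σ) / σ
        = ∑ i ∈ T, ∫ x in Ioi (0:ℝ), x ^ (-σ - 1) * (Ici (a i)).indicator (fun _ => w i) x := by
          apply Finset.sum_congr rfl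
          intro i _
          rw [(term_real (ha i) (by linarith) (w i)).2]
      _ = ∫ x in Ioi (0:ℝ), ∑ i ∈ T, x ^ (-σ - 1) * (Ici (a i)).indicator (fun _ => w i) x := by
          rw [integral_finsetSum]
          intro i _
          exact (term_real (ha i) (by linarith) (w i)).1
      _ ≤ _ := by
          apply setIntegral_mono_on _ hi measurableSet_Ioi
          · intro x hx
            simp only [mem_Ioi] at hx
            rw [← Finset.mul_sum]
            have h1 := sum_le_cnt hw hfin T x
            by_cases h : 1 ≤ x
            · simp only [indicator, mem_Ici, h, if_true]
              rw [show -(σ - 1) - 1 = (-σ - 1) + 1 by ring, Real.rpow_add_one hx.ne']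
              calc _ ≤ x ^ (-σ - 1) * (C * x) := by
                    gcongr
                    exact h1.trans (hC x h)
                _ = _ := by ring
            · rw [cnt_zero ha (not_le.mp h)] at h1
              simp only [indicator, mem_Ici, h, if_false]
              rw [mul_zero]
              exact mul_nonpos_of_nonneg_of_nonpos (by positivity) h1
          · apply integrable_finsetSum
            intro i _
            exact (term_real (ha i) (by linarith) (w i)).1
  have h2 := this.mul_right σ
  refine h2.congr (fun i => ?_)
  field_simp

lemma dirichlet_mellin [Countable ι] (ha : ∀ i, 1 ≤ a i) (hw : ∀ i, 0 ≤ w i)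
    (hfin : ∀ x, {i | a i ≤ x}.Finite) {s : ℂ} (hs : 0 < s.re)
    (hsum : Summable (fun i => w i * a i ^ (-s.re))) :
    HasSum (fun i => (w i : ℂ) * (a i : ℂ) ^ (-s))
      (s * mellin (fun x => (cnt a w x : ℂ)) (-s)) := by
  have hs0 : s ≠ 0 := by rintro rfl; simp at hs
  have h := hasSum_integral_of_summable_integral_norm (μ := volume.restrict (Ioi (0:ℝ)))
    (F := fun i (x : ℝ) => (x : ℂ) ^ (-s - 1) * ((Ici (a i)).indicator (fun _ => w i) x : ℝ))
    (fun i => (term_complex (ha i) hs (w i)).1) ?_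
  · have e : ∀ x : ℝ, ∑' i, (x : ℂ) ^ (-s - 1) * (((Ici (a i)).indicator (fun _ => w i) x : ℝ) : ℂ) =
        (x : ℂ) ^ (-s - 1) • (cnt a w x : ℂ) := by
      intro x
      rw [smul_eq_mul]
      exact ((hasSum_ofReal.mpr (cnt_hasSum hfin x)).mul_left _).tsum_eq
    simp only [e] at h
    have h2 := h.mul_left s
    rw [mellin]
    have hc : ∀ z : ℂ, s * (z / s) = z := fun z => by field_simp
    simp only [fun i => (term_complex (ha i) hs (w i)).2, hc] at h2
    exact h2
  · have h1 := hsum.div_const s.re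
    refine h1.congr (fun i => ?_)
    rw [← (term_real (ha i) hs (w i)).2]
    apply setIntegral_congr_fun measurableSet_Ioi
    intro x hx
    simp only [mem_Ioi] at hx
    simp only [norm_mul, norm_real]
    rw [norm_cpow_eq_rpow_re_of_pos hx, Real.norm_of_nonneg (indicator_nonneg (fun _ _ => hw i) _)]
    simp

theorem dirichlet_cont [Countable ι] (ha : ∀ i, 1 ≤ a i) (hw : ∀ i, 0 ≤ w i)
    (hfin : ∀ x, {i | a i ≤ x}.Finite) {c C κ : ℝ} (hC0 : 0 ≤ C) (hκ1 : κ < 1)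
    (hC : ∀ x, 1 ≤ x → |cnt a w x - c * x| ≤ C * x ^ κ) :
    ∃ E : ℂ → ℂ, (∀ s, κ < s.re → DifferentiableAt ℂ E s) ∧
      (∀ s, κ < s.re → ‖E s‖ ≤ C / (s.re - κ)) ∧
      ∀ s, 1 < s.re → Summable (fun i => w i * a i ^ (-s.re)) ∧
        HasSum (fun i => (w i : ℂ) * (a i : ℂ) ^ (-s)) (s * E s + c * (s / (s - 1))) := by
  set R : ℝ → ℝ := (Ici 1).indicator (fun x => cnt a w x - c * x) with hR
  have hRb : ∀ x, |R x| ≤ (Ici 1).indicator (fun x => C * x ^ κ) x := by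
    intro x
    by_cases h : 1 ≤ x
    · simp only [hR, indicator, mem_Ici, h, if_true]; exact hC x h
    · simp [hR, indicator, h]
  have hRl : LocallyIntegrable R := by
    rw [hR]
    have h1 : LocallyIntegrable (fun x => cnt a w x - c * x) :=
      ((cnt_mono hw hfin).locallyIntegrable).sub
        ((continuous_const.mul continuous_id).locallyIntegrable)
    exact h1.indicator measurableSet_Ici
  have hRc : LocallyIntegrableOn (fun x => (R x : ℂ)) (Ioi 0) := by
    intro x hx
    obtain ⟨t, ht, hi⟩ := hRl.locallyIntegrableOn (Ioi 0) x hx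
    exact ⟨t, ht, hi.ofReal⟩
  have htop : (fun x => (R x : ℂ)) =O[atTop] (fun x : ℝ => x ^ (-(-κ))) := by
    apply IsBigO.of_bound C
    filter_upwards [eventually_ge_atTop 1] with x hx
    have := hRb x
    simp only [indicator, mem_Ici, hx, if_true] at this
    rw [norm_real, neg_neg, Real.norm_eq_abs, Real.norm_of_nonneg (by positivity)]
    exact this
  have hbot : ∀ b : ℝ, (fun x => (R x : ℂ)) =O[𝓝[>] 0] (fun x : ℝ => x ^ (-b)) := by
    intro b
    apply IsBigO.of_bound 1
    have : ∀ᶠ x : ℝ in 𝓝[>] 0, x < 1 :=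
      (eventually_lt_nhds (by norm_num : (0:ℝ) < 1)).filter_mono nhdsWithin_le_nhds
    filter_upwards [this] with x hx
    have : R x = 0 := by simp [hR, hx]
    rw [this]; simp
  have hconv : ∀ s : ℂ, κ < s.re → MellinConvergent (fun x => (R x : ℂ)) (-s) := fun s hs =>
    mellinConvergent_of_isBigO_rpow hRc htop (by simpa using hs) (hbot ((-s).re - 1)) (by linarith)
  refine ⟨fun s => mellin (fun x => (R x : ℂ)) (-s), ?_, ?_, ?_⟩
  · intro s hs
    have := mellin_differentiableAt_of_isBigO_rpow (s := -s) hRc htop (by simpa using hs)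
      (hbot ((-s).re - 1)) (by linarith)
    exact this.comp s differentiableAt_id.neg
  · intro s hs
    have hi := term_real (b := 1) (σ := s.re - κ) le_rfl (by linarith) C
    simp only [mellin]
    calc _ ≤ ∫ x in Ioi (0:ℝ), x ^ (-(s.re - κ) - 1) * (Ici 1).indicator (fun _ => C) x := by
          apply norm_integral_le_of_norm_le hi.1
          rw [ae_restrict_iff' measurableSet_Ioi]
          refine Eventually.of_forall fun x hx => ?_
          simp only [mem_Ioi] at hx
          rw [norm_smul, norm_cpow_eq_rpow_re_of_pos hx, norm_real, Real.norm_eq_abs]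
          have := hRb x
          by_cases h : 1 ≤ x
          · simp only [indicator, mem_Ici, h, if_true] at this ⊢
            calc _ ≤ x ^ (-s - 1).re * (C * x ^ κ) := by gcongr
              _ = C * (x ^ (-s.re - 1) * x ^ κ) := by simp; ring
              _ = _ := by
                rw [← Real.rpow_add hx, mul_comm]; congr 2; ring
          · simp only [indicator, mem_Ici, h, if_false] at this ⊢
            rw [le_antisymm this (abs_nonneg _)]; simp
      _ = C / (s.re - κ) := by rw [hi.2]; simp
  · intro s hs
    have hcnt : ∀ x, 1 ≤ x → cnt a w x ≤ (C + |c|) * x := by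
      intro x hx
      have h1 := (abs_le.mp (hC x hx)).2
      have h2 : x ^ κ ≤ x := by
        conv_rhs => rw [← Real.rpow_one x]
        exact Real.rpow_le_rpow_of_exponent_le hx hκ1.le
      have h3 := le_abs_self c
      nlinarith
    have hsum := dirichlet_summable ha hw hfin hcnt hs
    refine ⟨hsum, ?_⟩
    have hm := dirichlet_mellin ha hw hfin (by linarith : 0 < s.re) hsum
    have hs1 : 0 < (s - 1).re := by simp; linarith
    have hs10 : s - 1 ≠ 0 := by intro h; rw [h] at hs1; simp at hs1
    have ht := term_complex (b := 1) (s := s - 1) le_rfl hs1 c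
    have hfun : EqOn (fun x : ℝ => (x : ℂ) ^ (-(s - 1) - 1) * ((Ici (1:ℝ)).indicator (fun _ => c) x : ℝ))
        (fun x : ℝ => (x : ℂ) ^ (-s - 1) • (((Ici (1:ℝ)).indicator (fun x => c * x) x : ℝ) : ℂ))
        (Ioi 0) := by
      intro x hx
      simp only [mem_Ioi] at hx
      have hx0 : (x : ℂ) ≠ 0 := by exact_mod_cast hx.ne'
      by_cases h : 1 ≤ x
      · simp only [indicator, mem_Ici, h, if_true, smul_eq_mul]
        rw [show -(s - 1) - 1 = (-s - 1) + 1 by ring, cpow_add _ _ hx0, cpow_one]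
        push_cast; ring
      · simp [indicator, h]
    have hmc : MellinConvergent (fun x => (((Ici (1:ℝ)).indicator (fun x => c * x) x : ℝ) : ℂ)) (-s) :=
      ht.1.congr_fun hfun measurableSet_Ioi
    have hmv : mellin (fun x => (((Ici (1:ℝ)).indicator (fun x => c * x) x : ℝ) : ℂ)) (-s)
        = c / (s - 1) := by
      rw [mellin, ← setIntegral_congr_fun measurableSet_Ioi hfun, ht.2]
      simp
    have hadd := (hasMellin_add (hconv s (by linarith)) hmc).2
    have e : (fun x => (cnt a w x : ℂ)) = fun x => (R x : ℂ) +
        (((Ici (1:ℝ)).indicator (fun x => c * x) x : ℝ) : ℂ) := by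
      ext x
      by_cases h : 1 ≤ x
      · simp [hR, indicator, h]
      · simp [hR, indicator, h, cnt_zero ha (not_le.mp h)]
    rw [e, hadd, hmv] at hm
    convert hm using 1
    field_simp

end BeurlingAux

namespace BeurlingAux
open Complex MeasureTheory Set Filter Topology Asymptotics

lemma halfplane_primitive (κ : ℝ) (f : ℂ → ℂ)
    (hf : DifferentiableOn ℂ f {s | κ < s.re}) :
    ∃ g : ℂ → ℂ, ∀ s : ℂ, κ < s.re → HasDerivAt g (f s) s := by
  have hne : ∀ w ∈ Metric.ball (0 : ℂ) 1, 1 - w ≠ 0 := by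
    intro w hw h
    have : w = 1 := (sub_eq_zero.mp h).symm
    simp [this] at hw
  have hre : ∀ w ∈ Metric.ball (0 : ℂ) 1, κ < ((κ : ℂ) + (1 + w) / (1 - w)).re := by
    intro w hw
    have h1 := hne w hw
    have h2 : 0 < normSq (1 - w) := normSq_pos.mpr h1
    have h3 : normSq w < 1 := by
      rw [normSq_eq_norm_sq]
      have : ‖w‖ < 1 := by simpa using hw
      have := norm_nonneg w
      nlinarith
    rw [normSq_apply] at h3
    simp only [add_re, ofReal_re, div_re, one_re, sub_re, add_im, one_im, sub_im]
    have : (1 + w.re) * (1 - w.re) / normSq (1 - w) + (0 + w.im) * (0 - w.im) / normSq (1 - w)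
      = (1 - (w.re * w.re + w.im * w.im)) / normSq (1 - w) := by
      field_simp; ring
    rw [this]
    have : 0 < (1 - (w.re * w.re + w.im * w.im)) / normSq (1 - w) := by
      apply div_pos _ h2; linarith
    linarith
  have hd : DifferentiableOn ℂ
      (fun w => f ((κ : ℂ) + (1 + w) / (1 - w)) * (2 / (1 - w) ^ 2)) (Metric.ball 0 1) := by
    apply DifferentiableOn.mul
    · apply DifferentiableOn.comp (t := {s | κ < s.re}) hf
      · intro w hw
        have := hne w hw
        apply DifferentiableAt.differentiableWithinAt
        fun_prop (disch := assumption)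
      · exact fun w hw => hre w hw
    · intro w hw
      have := hne w hw
      apply DifferentiableAt.differentiableWithinAt
      have h2 : (1 - w) ^ 2 ≠ 0 := pow_ne_zero 2 this
      fun_prop (disch := assumption)
  obtain ⟨G, hG⟩ := hd.isExactOn_ball
  refine ⟨fun s => G ((s - κ - 1) / (s - κ + 1)), fun s hs => ?_⟩
  have hs1 : s - κ + 1 ≠ 0 := by
    intro h
    have := congrArg re h
    simp at this
    linarith
  have hmem : (s - κ - 1) / (s - κ + 1) ∈ Metric.ball (0 : ℂ) 1 := by
    rw [mem_ball_zero_iff, norm_div, div_lt_one (norm_pos_iff.mpr hs1)]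
    rw [← sq_lt_sq₀ (norm_nonneg _) (norm_nonneg _), ← normSq_eq_norm_sq, ← normSq_eq_norm_sq,
      normSq_apply, normSq_apply]
    simp
    nlinarith
  have h1 := hG _ hmem
  have h2 : HasDerivAt (fun s : ℂ => (s - κ - 1) / (s - κ + 1)) (2 / (s - κ + 1) ^ 2) s := by
    have ha : HasDerivAt (fun s : ℂ => s - κ - 1) 1 s :=
      ((hasDerivAt_id s).sub_const _).sub_const _
    have hb : HasDerivAt (fun s : ℂ => s - κ + 1) 1 s :=
      ((hasDerivAt_id s).sub_const _).add_const _
    have hc := ha.fun_div hb hs1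
    rwa [show (1 * (s - κ + 1) - (s - κ - 1) * 1) = 2 by ring] at hc
  have h3 := h1.comp s h2
  simp only at h3
  have e1 : 1 - (s - κ - 1) / (s - κ + 1) = 2 / (s - κ + 1) := by field_simp; ring
  have e2 : 1 + (s - κ - 1) / (s - κ + 1) = 2 * (s - κ) / (s - κ + 1) := by field_simp; ring
  have e3 : (κ : ℂ) + (1 + (s - κ - 1) / (s - κ + 1)) / (1 - (s - κ - 1) / (s - κ + 1)) = s := by
    rw [e1, e2]; field_simp; ring
  rw [e3, e1] at h3
  have e4 : f s * (2 / (2 / (s - κ + 1)) ^ 2) * (2 / (s - κ + 1) ^ 2) = f s := by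
    field_simp
  rw [e4] at h3
  exact h3

/-- Borel–Carathéodory step. -/
lemma log_growth {κ₁ σ₁ C B : ℝ} (hκσ : κ₁ < σ₁) (hσ : σ₁ < 2) (hC : 1 ≤ C) (hB : 0 ≤ B)
    (H : ℂ → ℂ)
    (hd : ∀ s : ℂ, κ₁ < s.re → DifferentiableAt ℂ H s)
    (hre : ∀ s : ℂ, κ₁ < s.re → (H s).re ≤ Real.log (C * (‖s‖ + 1)))
    (h2 : ∀ s : ℂ, s.re = 2 → ‖H s‖ ≤ B) :
    ∃ A : ℝ, 0 < A ∧ ∀ s : ℂ, σ₁ ≤ s.re → s.re ≤ 2 → ‖H s‖ ≤ A * Real.log (|s.im| + 3) := by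
  set R := 2 - κ₁ with hR
  set r := 2 - σ₁ with hr
  have hrR : 0 < R - r := by simp [hR, hr]; linarith
  have hr0 : 0 < r := by simp [hr]; linarith
  have hR0 : 0 < R := by linarith
  have hlog1 : ∀ t : ℝ, 1 ≤ Real.log (|t| + 3) := by
    intro t
    rw [Real.le_log_iff_exp_le (by positivity)]
    have := Real.exp_one_lt_d9
    have := abs_nonneg t
    linarith
  set K := Real.log (C * (R + 3)) + 1 with hK
  have hK1 : 1 ≤ K := by
    have : 0 ≤ Real.log (C * (R + 3)) := Real.log_nonneg (by nlinarith)
    linarith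
  refine ⟨2 * (K + 1) * r / (R - r) + B * (R + r) / (R - r), by positivity, ?_⟩
  intro s hs1 hs2
  set t := s.im with ht
  have hl := hlog1 t
  set ℓ := Real.log (|t| + 3) with hℓ
  set M := (K + 1) * ℓ with hM
  have hMpos : 0 < M := by positivity
  have hbc := Complex.borelCaratheodory (M := M) (R := R) (f := fun z => H (2 + t * I + z))
    (z := ((s.re - 2 : ℝ) : ℂ)) hMpos ?_ ?_ (by linarith) ?_
  · have e : (2 : ℂ) + t * I + ((s.re - 2 : ℝ) : ℂ) = s := by
      apply Complex.ext <;> simp [ht]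
    simp only [e] at hbc
    have hz : ‖((s.re - 2 : ℝ) : ℂ)‖ = 2 - s.re := by
      rw [norm_real, Real.norm_eq_abs, abs_of_nonpos (by linarith)]; ring
    rw [hz] at hbc
    have h0 : ‖H (2 + t * I + 0)‖ ≤ B := h2 _ (by simp)
    have hle : 2 - s.re ≤ r := by simp [hr]; linarith
    have hden : R - r ≤ R - (2 - s.re) := by linarith
    calc ‖H s‖ ≤ _ := hbc
      _ ≤ 2 * M * r / (R - r) + B * (R + r) / (R - r) := by gcongr
      _ ≤ 2 * M * r / (R - r) + B * (R + r) / (R - r) * ℓ := by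
          have : 0 ≤ B * (R + r) / (R - r) := by positivity
          nlinarith
      _ = _ := by rw [hM]; ring
  · intro z hz
    have hz' : ‖z‖ < R := by simpa using hz
    have : κ₁ < (2 + t * I + z).re := by
      have := neg_abs_le z.re
      have := abs_re_le_norm z
      simp; linarith
    have hh := hd _ this
    apply DifferentiableAt.differentiableWithinAt
    exact hh.comp z ((differentiableAt_id).const_add _)
  · intro z hz
    have hz' : ‖z‖ < R := by simpa using hz
    have : κ₁ < (2 + t * I + z).re := by
      have := neg_abs_le z.re
      have := abs_re_le_norm z
      simp; linarith
    have hh := hre _ this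
    simp only [mem_ofPred_eq]
    refine hh.trans ?_
    have hn : ‖(2 + t * I + z : ℂ)‖ ≤ 2 + |t| + R := by
      calc _ ≤ ‖(2 + t * I : ℂ)‖ + ‖z‖ := norm_add_le _ _
        _ ≤ ‖(2:ℂ)‖ + ‖(t * I : ℂ)‖ + ‖z‖ := by gcongr; exact norm_add_le _ _
        _ ≤ _ := by simp; linarith
    have h3 : C * (‖(2 + t * I + z : ℂ)‖ + 1) ≤ (C * (R + 3)) * (|t| + 3) := by
      have : 0 ≤ |t| := abs_nonneg t
      have hRp : 0 < R := by linarith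
      rw [mul_assoc]
      gcongr
      nlinarith
    calc _ ≤ Real.log ((C * (R + 3)) * (|t| + 3)) := by
            apply Real.log_le_log _ h3
            positivity
      _ = Real.log (C * (R + 3)) + ℓ := by
            rw [Real.log_mul]
            · have : 0 < R := by linarith
              positivity
            · positivity
      _ ≤ M := by rw [hM]; nlinarith
  · rw [mem_ball_zero_iff, norm_real, Real.norm_eq_abs, abs_of_nonpos (by linarith)]
    linarith

/-- Three lines step: sublogarithmic growth. -/
lemma sublog_growth {σ₁ σ₀ A B δ : ℝ} (hσ1 : 0 < σ₁) (hσ : σ₁ < σ₀) (hσ0 : σ₀ < 2)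
    (hA : 0 < A) (hB : 0 ≤ B) (hδ : 0 < δ) (H : ℂ → ℂ)
    (hd : ∀ s : ℂ, σ₁ ≤ s.re → DifferentiableAt ℂ H s)
    (hlog : ∀ s : ℂ, σ₁ ≤ s.re → s.re ≤ 2 → ‖H s‖ ≤ A * Real.log (|s.im| + 3))
    (h2 : ∀ s : ℂ, s.re = 2 → ‖H s‖ ≤ B) :
    ∃ K : ℝ, ∀ s : ℂ, σ₀ ≤ s.re → s.re ≤ 2 → ‖H s‖ ≤ δ * Real.log (|s.im| + 3) + K := by
  have hlog1 : ∀ t : ℝ, 1 ≤ Real.log (|t| + 3) := by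
    intro t
    rw [Real.le_log_iff_exp_le (by positivity)]
    have := Real.exp_one_lt_d9
    have := abs_nonneg t
    linarith
  set θ := (σ₀ - σ₁) / (2 - σ₁) with hθ
  have hθ0 : 0 < θ := div_pos (by linarith) (by linarith)
  have hθ1 : θ < 1 := by rw [hθ, div_lt_one (by linarith)]; linarith
  set A' := 2 * A + B + 1 with hA'
  have hA'1 : 1 ≤ A' := by linarith
  have key : ∀ s : ℂ, σ₀ ≤ s.re → s.re ≤ 2 →
      ‖H s‖ ≤ 3 * A' * (Real.log (|s.im| + 3)) ^ (1 - θ) := by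
    intro s hs1 hs2
    set t := s.im with ht
    set ℓ := Real.log (|t| + 3) with hℓ
    have hl : 1 ≤ ℓ := hlog1 t
    set F : ℂ → ℂ := fun z => H (z + t * I) / (z + 1) with hF
    have hbd : ∀ z : ℂ, σ₁ ≤ z.re → z.re ≤ 2 → ‖F z‖ ≤ A' * ℓ := by
      intro z hz1 hz2
      have h := hlog (z + t * I) (by simpa using hz1) (by simpa using hz2)
      simp only [add_im, mul_im, ofReal_re, I_im, mul_one, ofReal_im, I_re, mul_zero, add_zero] at h
      have h3 : Real.log (|z.im + t| + 3) ≤ ℓ + |z.im| := by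
        have : |z.im + t| + 3 ≤ (|t| + 3) * Real.exp |z.im| := by
          have h1 := abs_add_le z.im t
          have h2 := Real.add_one_le_exp |z.im|
          have h3 := abs_nonneg t
          have h4 := abs_nonneg z.im
          nlinarith
        calc _ ≤ Real.log ((|t| + 3) * Real.exp |z.im|) := Real.log_le_log (by positivity) this
          _ = _ := by rw [Real.log_mul (by positivity) (Real.exp_ne_zero _), Real.log_exp]
      have hn1 : 1 ≤ ‖z + 1‖ := by
        have := re_le_norm (z + 1)
        simp at this; linarith
      have hn2 : |z.im| ≤ ‖z + 1‖ := by
        have := abs_im_le_norm (z + 1)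
        simpa using this
      rw [hF]
      simp only [norm_div]
      rw [div_le_iff₀ (by linarith)]
      calc _ ≤ A * (ℓ + |z.im|) := h.trans (by gcongr)
        _ ≤ A * (ℓ * ‖z + 1‖ + ℓ * ‖z + 1‖) := by
            gcongr
            · nlinarith
            · nlinarith
        _ = 2 * A * (ℓ * ‖z + 1‖) := by ring
        _ ≤ A' * (ℓ * ‖z + 1‖) := by gcongr; linarith
        _ = _ := by ring
    have hdF : ∀ z : ℂ, σ₁ ≤ z.re → DifferentiableAt ℂ F z := by
      intro z hz
      have h1 : DifferentiableAt ℂ (fun z => H (z + t * I)) z := by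
        have := hd (z + t * I) (by simpa using hz)
        exact this.comp z ((differentiableAt_id).add_const _)
      have h0 : z + 1 ≠ 0 := by
        intro h
        have := congrArg re h
        simp at this; linarith
      exact h1.div ((differentiableAt_id).add_const _) h0
    have h3l := Complex.HadamardThreeLines.norm_le_interp_of_mem_verticalClosedStrip'
      (f := F) (z := (s.re : ℂ)) (l := σ₁) (u := 2) (a := A' * ℓ) (b := A') (by linarith)
      (by simp [Complex.HadamardThreeLines.verticalClosedStrip]; constructor <;> linarith)
      ?_ ?_ ?_ ?_
    · have e : (s.re : ℂ) + t * I = s := by rw [ht]; exact re_add_im s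
      simp only [hF, e, norm_div, ofReal_re] at h3l
      set φ := (s.re - σ₁) / (2 - σ₁) with hφ
      have hφθ : θ ≤ φ := by
        rw [hφ, hθ]
        apply div_le_div_of_nonneg_right _ (by linarith)
        linarith
      have hn3 : ‖(s.re : ℂ) + 1‖ ≤ 3 := by
        rw [show (s.re : ℂ) + 1 = ((s.re + 1 : ℝ) : ℂ) by push_cast; rfl, norm_real,
          Real.norm_eq_abs, abs_of_nonneg (by linarith)]
        linarith
      have hn0 : 0 < ‖(s.re : ℂ) + 1‖ := by
        rw [show (s.re : ℂ) + 1 = ((s.re + 1 : ℝ) : ℂ) by push_cast; rfl, norm_real,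
          Real.norm_eq_abs, abs_of_nonneg (by linarith)]
        linarith
      rw [div_le_iff₀ hn0] at h3l
      have e2 : (A' * ℓ) ^ (1 - φ) * A' ^ φ = A' * ℓ ^ (1 - φ) := by
        rw [Real.mul_rpow (by linarith) (by linarith)]
        have : A' ^ (1 - φ) * A' ^ φ = A' := by
          rw [← Real.rpow_add (by linarith)]; simp
        calc _ = (A' ^ (1 - φ) * A' ^ φ) * ℓ ^ (1 - φ) := by ring
          _ = _ := by rw [this]
      rw [e2] at h3l
      have h5 : ℓ ^ (1 - φ) ≤ ℓ ^ (1 - θ) := Real.rpow_le_rpow_of_exponent_le hl (by linarith)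
      have h6 : 0 ≤ ℓ ^ (1 - φ) := by positivity
      calc _ ≤ A' * ℓ ^ (1 - φ) * ‖(s.re : ℂ) + 1‖ := h3l
        _ ≤ A' * ℓ ^ (1 - θ) * 3 := by gcongr
        _ = _ := by ring
    · apply DifferentiableOn.diffContOnCl
      intro z hz
      apply (hdF z _).differentiableWithinAt
      have : closure (Complex.HadamardThreeLines.verticalStrip σ₁ 2) ⊆ {z | σ₁ ≤ z.re} := by
        apply closure_minimal
        · intro z hz
          simp [Complex.HadamardThreeLines.verticalStrip] at hz
          exact hz.1.le
        · exact isClosed_le continuous_const continuous_re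
      exact this hz
    · refine ⟨A' * ℓ, ?_⟩
      rintro _ ⟨z, hz, rfl⟩
      simp [Complex.HadamardThreeLines.verticalClosedStrip] at hz
      exact hbd z hz.1 hz.2
    · intro z hz
      simp at hz
      exact hbd z hz.ge (by linarith)
    · intro z hz
      simp at hz
      have hn1 : 1 ≤ ‖z + 1‖ := by
        have := re_le_norm (z + 1)
        simp at this; linarith
      simp only [hF, norm_div]
      rw [div_le_iff₀ (by linarith)]
      have := h2 (z + t * I) (by simpa using hz)
      nlinarith
  have h : ∀ᶠ y : ℝ in atTop, y ^ (-θ) ≤ δ / (3 * A') :=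
    (tendsto_rpow_neg_atTop hθ0).eventually_le_const (by positivity)
  rw [eventually_atTop] at h
  obtain ⟨Y, hY⟩ := h
  set Y' := max Y 1 with hY'
  refine ⟨3 * A' * Y' ^ (1 - θ), fun s hs1 hs2 => (key s hs1 hs2).trans ?_⟩
  have hl := hlog1 s.im
  set ℓ := Real.log (|s.im| + 3) with hℓ
  have hY1 : 1 ≤ Y' := le_max_right _ _
  have hp : 0 ≤ Y' ^ (1 - θ) := by positivity
  rcases le_total Y ℓ with hc | hc
  · have h1 := hY ℓ hc
    replace h1 : ℓ ^ (1 - θ) ≤ δ / (3 * A') * ℓ := by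
      rw [sub_eq_add_neg, Real.rpow_add (by linarith), Real.rpow_one, mul_comm]
      gcongr
    have : 3 * A' * ℓ ^ (1 - θ) ≤ δ * ℓ := by
      calc _ ≤ 3 * A' * (δ / (3 * A') * ℓ) := by gcongr
        _ = _ := by field_simp
    have : 0 ≤ 3 * A' * Y' ^ (1 - θ) := by positivity
    linarith
  · have : ℓ ^ (1 - θ) ≤ Y' ^ (1 - θ) :=
      Real.rpow_le_rpow (by linarith) (hc.trans (le_max_left _ _)) (by linarith)
    have : 3 * A' * ℓ ^ (1 - θ) ≤ 3 * A' * Y' ^ (1 - θ) := by gcongr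
    have : 0 ≤ δ * ℓ := by positivity
    linarith

end BeurlingAux

namespace BeurlingAux
open Complex MeasureTheory Set Filter Topology Asymptotics

lemma s_lower {σ₀ : ℝ} (h0 : 0 < σ₀) {s : ℂ} (hs : σ₀ ≤ s.re) :
    σ₀ / (1 + σ₀) * (1 + |s.im|) ≤ ‖s‖ := by
  have h1 := (re_le_norm s)
  have h2 := (abs_im_le_norm s)
  rw [div_mul_eq_mul_div, div_le_iff₀ (by linarith)]
  nlinarith

lemma s1_lower {s : ℂ} (hs : 0 ≤ s.re) : 1 + |s.im| ≤ 2 * ‖s + 1‖ := by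
  have h1 := re_le_norm (s + 1)
  have h2 := abs_im_le_norm (s + 1)
  simp at h1 h2
  linarith

lemma mellin_kernel {s : ℂ} (hs : 0 < s.re) :
    HasMellin (fun x : ℝ => ((max (1 - x) 0 : ℝ) : ℂ)) s (1 / (s * (s + 1))) := by
  have h1 := hasMellin_one_Ioc hs
  have h2 := hasMellin_cpow_Ioc 1 (s := s) (by simp; linarith)
  have h := hasMellin_sub h1.1 h2.1
  rw [h1.2, h2.2] at h
  have hs0 : s ≠ 0 := by rintro rfl; simp at hs
  have hs1 : s + 1 ≠ 0 := by
    intro h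
    have := congrArg re h
    simp at this; linarith
  have e : 1 / s - 1 / (s + 1) = 1 / (s * (s + 1)) := by field_simp; ring
  rw [e] at h
  have hfun : EqOn (fun t : ℝ => (t : ℂ) ^ (s - 1) • ((Ioc (0:ℝ) 1).indicator (fun _ => (1:ℂ)) t -
      (Ioc (0:ℝ) 1).indicator (fun t => (t : ℂ) ^ (1:ℂ)) t))
      (fun x : ℝ => (x : ℂ) ^ (s - 1) • ((max (1 - x) 0 : ℝ) : ℂ)) (Ioi 0) := by
    intro x hx
    simp only [mem_Ioi] at hx
    by_cases h : x ≤ 1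
    · simp [indicator, hx, h]
    · push Not at h
      have : max (1 - x) 0 = 0 := max_eq_right (by linarith)
      simp [indicator, not_le.mpr h, this]
  constructor
  · exact (h.1).congr_fun hfun measurableSet_Ioi
  · rw [← h.2, mellin, mellin]
    exact (setIntegral_congr_fun measurableSet_Ioi hfun).symm

lemma vert_integrable : Integrable (fun y : ℝ => 1 / (((2:ℝ) + y * I : ℂ) * ((2:ℝ) + y * I + 1))) := by
  have hb : Integrable (fun y : ℝ => 3 * (1 + ‖y‖) ^ (-(2:ℝ))) :=
    (integrable_one_add_norm (by simp)).const_mul _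
  refine hb.mono' ?_ ?_
  · apply Continuous.aestronglyMeasurable
    apply Continuous.div continuous_const (by fun_prop)
    intro y h
    rcases mul_eq_zero.mp h with h | h <;> have := congrArg re h <;> simp at this
    norm_num at this
  · refine Eventually.of_forall fun y => ?_
    have h1 := s_lower (σ₀ := 2) (by norm_num) (s := (2:ℝ) + y * I) (by simp)
    have h2 := s1_lower (s := (2:ℝ) + y * I) (by simp)
    simp only [add_im, ofReal_im, mul_im, ofReal_re, I_im, mul_one, I_re, mul_zero, add_zero,
      zero_add] at h1 h2
    rw [norm_div, norm_one, norm_mul, Real.rpow_neg (by positivity), Real.norm_eq_abs,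
      ← div_eq_mul_inv]
    have hy := abs_nonneg y
    norm_num at h1 h2
    rw [div_le_div_iff₀ (by norm_num; nlinarith) (by positivity)]
    norm_num
    nlinarith

lemma kernel_inv {x : ℝ} (hx : 0 < x) :
    (1 / (2 * Real.pi) : ℂ) * ∫ y : ℝ, (x : ℂ) ^ (-((2:ℝ) + y * I : ℂ)) *
      (1 / (((2:ℝ) + y * I : ℂ) * ((2:ℝ) + y * I + 1))) = (max (1 - x) 0 : ℝ) := by
  have h := mellinInv_mellin_eq 2 (fun x : ℝ => ((max (1 - x) 0 : ℝ) : ℂ)) hx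
    (mellin_kernel (by simp)).1 ?_ (by fun_prop)
  · rw [← h, mellinInv]
    have : ∀ y : ℝ, mellin (fun x : ℝ => ((max (1 - x) 0 : ℝ) : ℂ)) (((2:ℝ):ℂ) + y * I) =
        1 / (((2:ℝ) + y * I : ℂ) * ((2:ℝ) + y * I + 1)) := fun y => (mellin_kernel (by simp)).2
    simp only [this, smul_eq_mul]
    rw [real_smul]
    push_cast
    rfl
  · rw [VerticalIntegrable]
    refine vert_integrable.congr (Eventually.of_forall fun y => ?_)
    exact (mellin_kernel (s := ((2:ℝ):ℂ) + y * I) (by simp)).2.symm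

lemma perron_sum {J : Type*} [Countable J] {n : J → ℝ} {c : J → ℂ} (hn : ∀ j, 1 ≤ n j)
    {D : ℂ → ℂ} (hsum : Summable (fun j => ‖c j‖ * n j ^ (-(2:ℝ))))
    (hD : ∀ y : ℝ, HasSum (fun j => c j * (n j : ℂ) ^ (-((2:ℝ) + y * I : ℂ))) (D ((2:ℝ) + y * I)))
    {x : ℝ} (hx : 0 < x) :
    HasSum (fun j => c j * (max (1 - n j / x) 0 : ℝ))
      ((1 / (2 * Real.pi) : ℂ) * ∫ y : ℝ, (x : ℂ) ^ ((2:ℝ) + y * I : ℂ) /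
        (((2:ℝ) + y * I : ℂ) * ((2:ℝ) + y * I + 1)) * D ((2:ℝ) + y * I)) := by
  have hcpow : ∀ j (y : ℝ), ((n j / x : ℝ) : ℂ) ^ (-((2:ℝ) + y * I : ℂ)) =
      (n j : ℂ) ^ (-((2:ℝ) + y * I : ℂ)) * (x : ℂ) ^ ((2:ℝ) + y * I : ℂ) := by
    intro j y
    have := hn j
    have hx0 : (x:ℂ) ≠ 0 := by exact_mod_cast hx.ne'
    rw [div_eq_mul_inv, ofReal_mul, mul_cpow_ofReal_nonneg (by linarith) (by positivity)]
    congr 1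
    rw [ofReal_inv, inv_cpow _ _ (by rw [arg_ofReal_of_nonneg hx.le]; exact Real.pi_pos.ne),
      ← cpow_neg, neg_neg]
  have hnorm : ∀ j (y : ℝ), ‖((n j / x : ℝ) : ℂ) ^ (-((2:ℝ) + y * I : ℂ))‖ =
      (n j) ^ (-(2:ℝ)) * x ^ (2:ℝ) := by
    intro j y
    have := hn j
    rw [norm_cpow_eq_rpow_re_of_pos (by positivity)]
    simp only [neg_re, add_re, ofReal_re, mul_re, I_re, mul_zero, ofReal_im, I_im, mul_one,
      sub_self, add_zero]
    rw [Real.div_rpow (by linarith) hx.le, Real.rpow_neg hx.le, div_inv_eq_mul]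
  have hintg : ∀ j, Integrable (fun y : ℝ => c j * (((n j / x : ℝ) : ℂ) ^ (-((2:ℝ) + y * I : ℂ)) *
      (1 / (((2:ℝ) + y * I : ℂ) * ((2:ℝ) + y * I + 1))))) := by
    intro j
    apply Integrable.const_mul
    apply vert_integrable.bdd_mul (c := (n j) ^ (-(2:ℝ)) * x ^ (2:ℝ))
    · apply Continuous.aestronglyMeasurable
      have := hn j
      have h0 : ((n j / x : ℝ) : ℂ) ≠ 0 := by
        have : 0 < n j / x := by positivity
        exact_mod_cast this.ne'
      exact Continuous.const_cpow (by fun_prop) (Or.inl h0)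
    · exact Eventually.of_forall fun y => (hnorm j y).le
  have h := hasSum_integral_of_summable_integral_norm hintg ?_
  · have h2 := h.mul_left (1 / (2 * Real.pi) : ℂ)
    simp only [integral_const_mul] at h2
    have hterm : ∀ j, (1 / (2 * Real.pi) : ℂ) * (c j * ∫ y : ℝ,
        (((n j / x : ℝ) : ℂ) ^ (-((2:ℝ) + y * I : ℂ)) *
        (1 / (((2:ℝ) + y * I : ℂ) * ((2:ℝ) + y * I + 1))))) =
        c j * (max (1 - n j / x) 0 : ℝ) := by
      intro j
      have := hn j
      rw [← kernel_inv (x := n j / x) (by positivity)]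
      ring
    simp only [hterm] at h2
    have hI : (fun y : ℝ => (x : ℂ) ^ ((2:ℝ) + y * I : ℂ) /
        (((2:ℝ) + y * I : ℂ) * ((2:ℝ) + y * I + 1)) * D ((2:ℝ) + y * I)) =
        fun y : ℝ => ∑' j, c j * (((n j / x : ℝ) : ℂ) ^ (-((2:ℝ) + y * I : ℂ)) *
          (1 / (((2:ℝ) + y * I : ℂ) * ((2:ℝ) + y * I + 1)))) := by
      funext y
      have h3 := ((hD y).mul_right ((x : ℂ) ^ ((2:ℝ) + y * I : ℂ) *
        (1 / (((2:ℝ) + y * I : ℂ) * ((2:ℝ) + y * I + 1))))).tsum_eq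
      calc _ = D ((2:ℝ) + y * I) * ((x : ℂ) ^ ((2:ℝ) + y * I : ℂ) *
        (1 / (((2:ℝ) + y * I : ℂ) * ((2:ℝ) + y * I + 1)))) := by ring
        _ = _ := by
          rw [← h3]
          apply tsum_congr
          intro j
          rw [hcpow]; ring
    rw [hI]
    exact h2
  · have h1 := hsum.mul_right (x ^ (2:ℝ) * ∫ y : ℝ,
      ‖(1 / (((2:ℝ) + y * I : ℂ) * ((2:ℝ) + y * I + 1)))‖)
    refine h1.congr fun j => ?_
    rw [← integral_const_mul, ← integral_const_mul]
    congr 1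
    ext y
    rw [norm_mul, norm_mul, hnorm]
    ring

/-- Moving a line of integration. -/
lemma shift_line {a b K r : ℝ} (hab : a ≤ b) (hr : 1 < r) (g : ℂ → ℂ)
    (hd : ∀ s : ℂ, a ≤ s.re → s.re ≤ b → DifferentiableAt ℂ g s)
    (hb : ∀ s : ℂ, a ≤ s.re → s.re ≤ b → ‖g s‖ ≤ K * (1 + |s.im|) ^ (-r)) :
    ∫ y : ℝ, g (b + y * I) = ∫ y : ℝ, g (a + y * I) := by
  have hintg : ∀ σ : ℝ, a ≤ σ → σ ≤ b → Integrable (fun y : ℝ => g (σ + y * I)) := by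
    intro σ h1 h2
    have hbi : Integrable (fun y : ℝ => K * (1 + ‖y‖) ^ (-r)) :=
      (integrable_one_add_norm (by simpa using hr)).const_mul _
    refine hbi.mono' ?_ ?_
    · apply Continuous.aestronglyMeasurable
      rw [continuous_iff_continuousAt]
      intro y
      have hc := (hd (σ + y * I) (by simpa using h1) (by simpa using h2)).continuousAt
      exact ContinuousAt.comp (f := fun y : ℝ => (σ + y * I : ℂ)) hc (by fun_prop)
    · refine Eventually.of_forall fun y => ?_
      have := hb (σ + y * I) (by simpa using h1) (by simpa using h2)
      simpa using this
  have hrect : ∀ T : ℝ, 0 < T → ‖(∫ y in (-T)..T, g (b + y * I)) - ∫ y in (-T)..T, g (a + y * I)‖ ≤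
      2 * (K * (1 + T) ^ (-r) * (b - a)) := by
    intro T hT
    have h := integral_boundary_rect_eq_zero_of_differentiableOn g (a + (-T : ℝ) * I) (b + T * I) ?_
    · simp only [add_re, ofReal_re, mul_re, I_re, mul_zero, ofReal_im, I_im, mul_one, sub_self,
        add_zero, add_im, mul_im, zero_add, smul_eq_mul] at h
      have hbound : ∀ T' : ℝ, |T'| = T → ‖∫ x in a..b, g (x + T' * I)‖ ≤
          K * (1 + T) ^ (-r) * (b - a) := by
        intro T' hT'
        have := intervalIntegral.norm_integral_le_of_norm_le_const (a := a) (b := b)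
          (f := fun x : ℝ => g (x + T' * I)) (C := K * (1 + T) ^ (-r)) ?_
        · rwa [abs_of_nonneg (by linarith)] at this
        · intro x hx
          rw [uIoc_of_le hab] at hx
          have := hb (x + T' * I) (by simpa using hx.1.le) (by simpa using hx.2)
          simpa [hT'] using this
      have h1 := hbound (-T) (by rw [abs_neg, abs_of_pos hT])
      have h2 := hbound T (abs_of_pos hT)
      have e : (∫ y in (-T)..T, g (b + y * I)) - ∫ y in (-T)..T, g (a + y * I) =
        I * ((∫ x in a..b, g (x + (-T : ℝ) * I)) - ∫ x in a..b, g (x + T * I)) := by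
        have hI : I * I = -1 := I_mul_I
        linear_combination (-I) * h + ((∫ y in (-T)..T, g (b + y * I)) - ∫ y in (-T)..T, g (a + y * I)) * hI
      rw [e, norm_mul, norm_I, one_mul]
      exact (norm_sub_le _ _).trans (by linarith)
    · intro s hs
      rw [mem_reProdIm] at hs
      simp only [add_re, ofReal_re, mul_re, I_re, mul_zero, ofReal_im, I_im, mul_one, sub_self,
        add_zero] at hs
      rw [uIcc_of_le hab] at hs
      exact (hd s hs.1.1 hs.1.2).differentiableWithinAt
  have ht1 := intervalIntegral_tendsto_integral (hintg b hab le_rfl) tendsto_neg_atTop_atBot tendsto_id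
  have ht2 := intervalIntegral_tendsto_integral (hintg a le_rfl hab) tendsto_neg_atTop_atBot tendsto_id
  have ht := (ht1.sub ht2).norm
  have hz : Tendsto (fun T : ℝ => 2 * (K * (1 + T) ^ (-r) * (b - a))) atTop (𝓝 0) := by
    have h1 : Tendsto (fun T : ℝ => (1 + T) ^ (-r)) atTop (𝓝 0) :=
      (tendsto_rpow_neg_atTop (by linarith)).comp (tendsto_atTop_add_const_left _ _ tendsto_id)
    have := ((h1.const_mul K).mul_const (b - a)).const_mul 2
    simpa using this
  have hle := le_of_tendsto_of_tendsto ht hz (by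
    filter_upwards [eventually_gt_atTop 0] with T hT
    exact hrect T hT)
  exact sub_eq_zero.mp (norm_le_zero_iff.mp hle)

lemma cpow_diff {σ₀ x : ℝ} (h0 : 0 ≤ σ₀) (hx : 1 ≤ x) {s : ℂ} (hs : s.re = σ₀) {η : ℝ}
    (hη0 : 0 ≤ η) (hη1 : η ≤ 1) :
    ‖((x + 1 : ℝ) : ℂ) ^ (s + 1) - (x : ℂ) ^ (s + 1)‖ ≤
      2 * ‖s + 1‖ ^ (1 - η) * (x + 1) ^ (σ₀ + η) := by
  set X := x + 1 with hX
  have hA : ‖((X : ℝ) : ℂ) ^ (s + 1) - (x : ℂ) ^ (s + 1)‖ ≤ ‖s + 1‖ * X ^ σ₀ := by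
    have := Convex.norm_image_sub_le_of_norm_hasDerivWithin_le (s := Icc x X)
      (f := fun u : ℝ => (u : ℂ) ^ (s + 1)) (f' := fun u : ℝ => (s + 1) * (u : ℂ) ^ (s + 1 - 1))
      (C := ‖s + 1‖ * X ^ σ₀) (x := x) (y := X) ?_ ?_ (convex_Icc _ _) (by simp [hX]) (by simp [hX])
    · simpa [hX] using this
    · intro u hu
      have hu0 : u ≠ 0 := by have := hu.1; intro h; linarith
      exact (hasDerivAt_ofReal_cpow_const hu0 (by
        intro h
        have := congrArg re h
        simp at this; linarith)).hasDerivWithinAt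
    · intro u hu
      have hu0 : 0 < u := by have := hu.1; linarith
      rw [norm_mul, norm_cpow_eq_rpow_re_of_pos hu0]
      simp only [add_sub_cancel_right, hs]
      gcongr
      exact hu.2
  have hB : ‖((X : ℝ) : ℂ) ^ (s + 1) - (x : ℂ) ^ (s + 1)‖ ≤ 2 * X ^ (σ₀ + 1) := by
    refine (norm_sub_le _ _).trans ?_
    rw [norm_cpow_eq_rpow_re_of_pos (by linarith), norm_cpow_eq_rpow_re_of_pos (by linarith)]
    simp only [add_re, one_re, hs]
    have : x ^ (σ₀ + 1) ≤ X ^ (σ₀ + 1) := by gcongr; linarith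
    linarith
  set q := ‖((X : ℝ) : ℂ) ^ (s + 1) - (x : ℂ) ^ (s + 1)‖ with hq
  have hq0 : 0 ≤ q := norm_nonneg _
  have hX0 : 0 < X := by linarith
  calc q = q ^ (1 - η) * q ^ η := by
        rw [← Real.rpow_add_of_nonneg hq0 (by linarith) hη0]; simp
    _ ≤ (‖s + 1‖ * X ^ σ₀) ^ (1 - η) * (2 * X ^ (σ₀ + 1)) ^ η := by
        gcongr
    _ = 2 ^ η * ‖s + 1‖ ^ (1 - η) * X ^ (σ₀ + η) := by
        rw [Real.mul_rpow (norm_nonneg _) (by positivity), Real.mul_rpow (by norm_num) (by positivity),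
          ← Real.rpow_mul hX0.le, ← Real.rpow_mul hX0.le]
        rw [show σ₀ + η = σ₀ * (1 - η) + (σ₀ + 1) * η by ring, Real.rpow_add hX0]
        ring
    _ ≤ _ := by
        gcongr
        calc (2:ℝ) ^ η ≤ 2 ^ (1:ℝ) := Real.rpow_le_rpow_of_exponent_le (by norm_num) hη1
          _ = 2 := by norm_num

theorem perron_bound {J : Type*} [Countable J] {n : J → ℝ} {c : J → ℂ} (hn : ∀ j, 1 ≤ n j)
    {D : ℂ → ℂ} (hsum : Summable (fun j => ‖c j‖ * n j ^ (-(2:ℝ))))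
    (hD : ∀ y : ℝ, HasSum (fun j => c j * (n j : ℂ) ^ (-((2:ℝ) + y * I : ℂ))) (D ((2:ℝ) + y * I)))
    {σ₀ δ C : ℝ} (h0 : 0 < σ₀) (h2 : σ₀ ≤ 2) (hδ : 0 < δ) (hδ1 : δ ≤ 1 / 4) (hC : 0 ≤ C)
    (hd : ∀ s : ℂ, σ₀ ≤ s.re → DifferentiableAt ℂ D s)
    (hb : ∀ s : ℂ, σ₀ ≤ s.re → s.re ≤ 2 → ‖D s‖ ≤ C * (|s.im| + 3) ^ δ) :
    ∃ K : ℝ, 0 ≤ K ∧ ∀ x : ℝ, 1 ≤ x → ∃ v : ℂ, ‖v‖ ≤ K * (x + 1) ^ (σ₀ + 2 * δ) ∧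
      HasSum (fun j => c j * ((max (x + 1 - n j) 0 - max (x - n j) 0 : ℝ) : ℂ)) v := by
  set L := σ₀ / (1 + σ₀) with hL
  have hLpos : 0 < L := by positivity
  have hDb : ∀ s : ℂ, σ₀ ≤ s.re → s.re ≤ 2 → ‖D s‖ ≤ 3 * C * (1 + |s.im|) ^ δ := by
    intro s h1 h2
    refine (hb s h1 h2).trans ?_
    have : (|s.im| + 3) ^ δ ≤ 3 * (1 + |s.im|) ^ δ := by
      calc (|s.im| + 3) ^ δ ≤ (3 * (1 + |s.im|)) ^ δ := by
            gcongr
            have := abs_nonneg s.im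
            linarith
        _ = 3 ^ δ * (1 + |s.im|) ^ δ := Real.mul_rpow (by norm_num) (by positivity)
        _ ≤ 3 * (1 + |s.im|) ^ δ := by
            gcongr
            calc (3:ℝ) ^ δ ≤ 3 ^ (1:ℝ) :=
                  Real.rpow_le_rpow_of_exponent_le (by norm_num) (by linarith)
              _ = 3 := by norm_num
    nlinarith
  set G : ℝ → ℂ → ℂ := fun x s => (x : ℂ) ^ s / (s * (s + 1)) * D s with hG
  have hsne : ∀ s : ℂ, σ₀ ≤ s.re → s ≠ 0 ∧ s + 1 ≠ 0 := by
    intro s hs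
    constructor <;> intro h <;> have := congrArg re h <;> simp at this <;> linarith
  have hGd : ∀ x : ℝ, 1 ≤ x → ∀ s : ℂ, σ₀ ≤ s.re → DifferentiableAt ℂ (G x) s := by
    intro x hx s hs
    obtain ⟨h1, h2⟩ := hsne s hs
    have hx0 : (x : ℂ) ≠ 0 := by
      have : 0 < x := by linarith
      exact_mod_cast this.ne'
    have := hd s hs
    have h3 : s * (s + 1) ≠ 0 := mul_ne_zero h1 h2
    have h4 : DifferentiableAt ℂ (fun s : ℂ => (x : ℂ) ^ s) s :=
      differentiableAt_id.const_cpow (Or.inl hx0)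
    exact (h4.div (by fun_prop) h3).mul this
  have hGb : ∀ x : ℝ, 1 ≤ x → ∀ s : ℂ, σ₀ ≤ s.re → s.re ≤ 2 →
      ‖G x s‖ ≤ (x ^ (2:ℝ) * (2 / L) * (3 * C)) * (1 + |s.im|) ^ (-(2 - δ)) := by
    intro x hx s h1 h2
    have hl1 := s_lower h0 h1
    have hl2 := s1_lower (s := s) (by linarith)
    have hy : 0 < 1 + |s.im| := by positivity
    have hsp : L * (1 + |s.im|) * ((1 + |s.im|) / 2) ≤ ‖s‖ * ‖s + 1‖ := by
      gcongr
      linarith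
    simp only [hG, norm_mul, norm_div]
    rw [norm_cpow_eq_rpow_re_of_pos (by linarith)]
    have e : (x ^ (2:ℝ) * (2 / L) * (3 * C)) * (1 + |s.im|) ^ (-(2 - δ)) =
      x ^ (2:ℝ) / (L * (1 + |s.im|) * ((1 + |s.im|) / 2)) * (3 * C * (1 + |s.im|) ^ δ) := by
      rw [show -(2 - δ) = δ - 2 by ring, Real.rpow_sub hy, Real.rpow_ofNat (1 + |s.im|) 2]
      field_simp
    rw [e]
    gcongr
    exact hDb s h1 h2
  have hintg : ∀ x : ℝ, 1 ≤ x → Integrable (fun y : ℝ => G x (σ₀ + y * I)) := by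
    intro x hx
    have hbi : Integrable (fun y : ℝ => (x ^ (2:ℝ) * (2 / L) * (3 * C)) * (1 + ‖y‖) ^ (-(2 - δ))) :=
      (integrable_one_add_norm (by simp; linarith)).const_mul _
    refine hbi.mono' ?_ ?_
    · apply Continuous.aestronglyMeasurable
      rw [continuous_iff_continuousAt]
      intro y
      have hc := (hGd x hx (σ₀ + y * I) (by simp)).continuousAt
      exact ContinuousAt.comp (f := fun y : ℝ => (σ₀ + y * I : ℂ)) hc (by fun_prop)
    · refine Eventually.of_forall fun y => ?_
      have := hGb x hx (σ₀ + y * I) (by simp) (by simpa using h2)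
      simpa using this
  have hP : ∀ x : ℝ, 1 ≤ x → HasSum (fun j => c j * (max (x - n j) 0 : ℝ))
      ((1 / (2 * Real.pi) : ℂ) * ∫ y : ℝ, x * G x (σ₀ + y * I)) := by
    intro x hx
    have h1 := perron_sum hn hsum hD (x := x) (by linarith)
    have h3 := shift_line h2 (r := 2 - δ) (by linarith) (G x) (fun s h _ => hGd x hx s h) (hGb x hx)
    have h4 : (∫ y : ℝ, (x : ℂ) ^ ((2:ℝ) + y * I : ℂ) /
        (((2:ℝ) + y * I : ℂ) * ((2:ℝ) + y * I + 1)) * D ((2:ℝ) + y * I)) =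
        ∫ y : ℝ, G x (σ₀ + y * I) := h3
    rw [h4] at h1
    have h5 := h1.mul_left (x : ℂ)
    rw [integral_const_mul]
    have hf : (fun j => c j * ((max (x - n j) 0 : ℝ) : ℂ)) =
        fun j => (x : ℂ) * (c j * ((max (1 - n j / x) 0 : ℝ) : ℂ)) := by
      funext j
      have : max (x - n j) 0 = x * max (1 - n j / x) 0 := by
        rw [mul_max_of_nonneg _ _ (by linarith : (0:ℝ) ≤ x), mul_zero]
        congr 1
        have : x ≠ 0 := by linarith
        field_simp
      rw [this, ofReal_mul]; ring
    rw [hf, show (1 / (2 * Real.pi) : ℂ) * (x * ∫ y : ℝ, G x (σ₀ + y * I)) =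
      x * ((1 / (2 * Real.pi) : ℂ) * ∫ y : ℝ, G x (σ₀ + y * I)) by ring]
    exact h5
  have hrint : Integrable (fun y : ℝ => (1 + ‖y‖) ^ (-(1 + δ))) :=
    integrable_one_add_norm (by simp; linarith)
  set Q := ∫ y : ℝ, (1 + ‖y‖) ^ (-(1 + δ)) with hQ
  have hQ0 : 0 ≤ Q := integral_nonneg fun y => by positivity
  refine ⟨1 / (2 * Real.pi) * (24 * C / L * Q), by positivity, fun x hx => ?_⟩
  refine ⟨(1 / (2 * Real.pi) : ℂ) * ∫ y : ℝ, ((x + 1 : ℝ) * G (x + 1) (σ₀ + y * I) -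
    x * G x (σ₀ + y * I)), ?_, ?_⟩
  · have hbd : ‖∫ y : ℝ, (((x + 1 : ℝ) : ℂ) * G (x + 1) (σ₀ + y * I) - x * G x (σ₀ + y * I))‖ ≤
        ∫ y : ℝ, (24 * C / L * (x + 1) ^ (σ₀ + 2 * δ)) * (1 + ‖y‖) ^ (-(1 + δ)) := by
      apply norm_integral_le_of_norm_le (hrint.const_mul _)
      refine Eventually.of_forall fun y => ?_
      set s : ℂ := σ₀ + y * I with hs
      have hsre : s.re = σ₀ := by simp [hs]
      have hsim : s.im = y := by simp [hs]
      obtain ⟨hs0, hs1⟩ := hsne s hsre.ge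
      have hx0 : (x : ℂ) ≠ 0 := by
        have : 0 < x := by linarith
        exact_mod_cast this.ne'
      have hX0 : ((x + 1 : ℝ) : ℂ) ≠ 0 := by
        have : 0 < x + 1 := by linarith
        exact_mod_cast this.ne'
      have e : ((x + 1 : ℝ) : ℂ) * G (x + 1) s - x * G x s =
          (((x + 1 : ℝ) : ℂ) ^ (s + 1) - (x : ℂ) ^ (s + 1)) / (s * (s + 1)) * D s := by
        simp only [hG]
        rw [cpow_add s 1 hx0, cpow_add s 1 hX0, cpow_one, cpow_one]
        ring
      rw [e, norm_mul, norm_div, norm_mul]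
      have hl1 := s_lower h0 hsre.ge
      have hl2 := s1_lower (s := s) (by linarith)
      rw [hsim] at hl1 hl2
      have hdiff := cpow_diff h0.le hx hsre (η := 2 * δ) (by linarith) (by linarith)
      have hDs := hDb s hsre.ge (by linarith)
      rw [hsim] at hDs
      have hn0 : 0 < ‖s‖ := norm_pos_iff.mpr hs0
      have hn1 : 0 < ‖s + 1‖ := norm_pos_iff.mpr hs1
      rw [Real.norm_eq_abs]
      have hy : 0 < 1 + |y| := by positivity
      have hpow : ((1 + |y|) / 2) ^ (2 * δ) ≤ ‖s + 1‖ ^ (2 * δ) := by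
        gcongr
        linarith
      have hpow2 : (1 + |y|) ^ (2 * δ) / 2 ≤ ((1 + |y|) / 2) ^ (2 * δ) := by
        rw [Real.div_rpow hy.le (by norm_num)]
        gcongr
        calc (2:ℝ) ^ (2 * δ) ≤ 2 ^ (1:ℝ) :=
              Real.rpow_le_rpow_of_exponent_le (by norm_num) (by linarith)
          _ = 2 := by norm_num
      calc _ ≤ (2 * ‖s + 1‖ ^ (1 - 2 * δ) * (x + 1) ^ (σ₀ + 2 * δ)) / (‖s‖ * ‖s + 1‖) *
            (3 * C * (1 + |y|) ^ δ) := by gcongr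
        _ = 6 * C * (x + 1) ^ (σ₀ + 2 * δ) * (1 + |y|) ^ δ / (‖s‖ * ‖s + 1‖ ^ (2 * δ)) := by
            rw [Real.rpow_sub hn1, Real.rpow_one]
            field_simp
            ring
        _ ≤ 6 * C * (x + 1) ^ (σ₀ + 2 * δ) * (1 + |y|) ^ δ /
            ((L * (1 + |y|)) * ((1 + |y|) ^ (2 * δ) / 2)) := by
            gcongr
            exact hpow2.trans hpow
        _ = 12 * C / L * (x + 1) ^ (σ₀ + 2 * δ) * ((1 + |y|) ^ δ / ((1 + |y|) * (1 + |y|) ^ (2 * δ))) := by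
            field_simp
            ring
        _ = 12 * C / L * (x + 1) ^ (σ₀ + 2 * δ) * (1 + |y|) ^ (-(1 + δ)) := by
            congr 1
            rw [← Real.rpow_one_add' hy.le (by linarith), ← Real.rpow_sub hy]
            congr 1; ring
        _ ≤ _ := by
            gcongr
            norm_num
    rw [integral_const_mul, ← hQ] at hbd
    rw [norm_mul]
    have hpi : ‖(1 / (2 * Real.pi) : ℂ)‖ = 1 / (2 * Real.pi) := by
      rw [show (1 / (2 * Real.pi) : ℂ) = ((1 / (2 * Real.pi) : ℝ) : ℂ) by push_cast; rfl, norm_real,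
        Real.norm_of_nonneg (by positivity)]
    rw [hpi]
    calc _ ≤ 1 / (2 * Real.pi) * (24 * C / L * (x + 1) ^ (σ₀ + 2 * δ) * Q) := by gcongr
      _ = _ := by ring
  · have h1 := (hP (x + 1) (by linarith)).sub (hP x hx)
    rw [integral_sub ((hintg _ (by linarith)).const_mul _) ((hintg _ hx).const_mul _), mul_sub]
    have hf : (fun j => c j * ((max (x + 1 - n j) 0 - max (x - n j) 0 : ℝ) : ℂ)) =
        fun j => c j * ((max (x + 1 - n j) 0 : ℝ) : ℂ) - c j * ((max (x - n j) 0 : ℝ) : ℂ) := by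
      funext j
      rw [ofReal_sub, mul_sub]
    rw [hf]
    exact h1

end BeurlingAux

namespace BeurlingAux
open Complex MeasureTheory Set Filter Topology Asymptotics

/-- the indicator of a finite set as a finitely supported function -/
noncomputable def ind (S : Finset ℕ) : ℕ →₀ ℕ :=
  Finsupp.indicator S (fun _ _ => 1)

lemma ind_apply (S : Finset ℕ) (i : ℕ) : ind S i = if i ∈ S then 1 else 0 := by
  simp [ind, Finsupp.indicator_apply]

lemma ind_support (S : Finset ℕ) : (ind S).support = S := by
  ext i; simp [ind_apply]

lemma ind_inj : Function.Injective ind := by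
  intro S T h
  rw [← ind_support S, h, ind_support]

lemma ind_prod {R : Type*} [CommMonoid R] (z : ℕ → R) (S : Finset ℕ) :
    ((ind S).prod fun i k => z i ^ k) = ∏ i ∈ S, z i := by
  rw [Finsupp.prod, ind_support]
  apply Finset.prod_congr rfl
  intro i hi
  simp [ind_apply, hi]

/-- multisets plus a marked set of its primes -/
noncomputable def pairEquiv :
    (ℕ →₀ ℕ) × Finset ℕ ≃ Σ g : ℕ →₀ ℕ, {S : Finset ℕ // S ∈ g.support.powerset} where
  toFun q := ⟨q.1 + ind q.2, ⟨q.2, by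
    rw [Finset.mem_powerset]
    intro i hi
    simp [ind_apply, hi]⟩⟩
  invFun r := (r.1 - ind r.2.1, r.2.1)
  left_inv q := by
    simp
  right_inv r := by
    obtain ⟨g, S, hS⟩ := r
    have h : g - ind S + ind S = g := by
      ext i
      rw [Finset.mem_powerset] at hS
      simp only [Finsupp.coe_add, Finsupp.coe_tsub, Pi.add_apply, Pi.sub_apply, ind_apply]
      split_ifs with hi
      · have := hS hi
        rw [Finsupp.mem_support_iff] at this
        omega
      · simp
    simp only [Sigma.mk.injEq]
    refine ⟨h, ?_⟩
    congr! 1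
    rw [h]

lemma euler (z : ℕ → ℂ) (hZ : Summable fun e : ℕ →₀ ℕ => ‖e.prod fun i k => z i ^ k‖) :
    Summable (fun i => ‖z i‖) ∧ Summable (fun S : Finset ℕ => ‖∏ i ∈ S, (-z i)‖) ∧
    (∑' e : ℕ →₀ ℕ, e.prod fun i k => z i ^ k) * ∑' S : Finset ℕ, ∏ i ∈ S, (-z i) = 1 := by
  have h1 : Summable (fun i => ‖z i‖) := by
    have := hZ.comp_injective (Finsupp.single_left_injective (α := ℕ) (b := 1) one_ne_zero)
    refine this.congr fun i => ?_
    simp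
  have h2 : Summable (fun S : Finset ℕ => ‖∏ i ∈ S, (-z i)‖) := by
    have := hZ.comp_injective ind_inj
    refine this.congr fun S => ?_
    simp only [Function.comp_apply, ind_prod, norm_prod, norm_neg]
  refine ⟨h1, h2, ?_⟩
  rw [tsum_mul_tsum_of_summable_norm hZ h2]
  have hs := (summable_mul_of_summable_norm hZ h2)
  set F : (Σ g : ℕ →₀ ℕ, {S : Finset ℕ // S ∈ g.support.powerset}) → ℂ :=
    fun r => (r.1.prod fun i k => z i ^ k) * (-1) ^ r.2.1.card with hF
  have hFe : ∀ q : (ℕ →₀ ℕ) × Finset ℕ,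
      (q.1.prod fun i k => z i ^ k) * ∏ i ∈ q.2, (-z i) = F (pairEquiv q) := by
    intro q
    simp only [hF, pairEquiv, Equiv.coe_fn_mk]
    rw [Finsupp.prod_add_index' (by simp) (by intros; rw [pow_add]), ind_prod, Finset.prod_neg]
    ring
  simp only [hFe] at hs ⊢
  have hs' : Summable F := (pairEquiv.summable_iff).mp hs
  rw [pairEquiv.tsum_eq F, hs'.tsum_sigma]
  rw [tsum_eq_single 0]
  · simp only [hF, Finsupp.prod_zero_index, one_mul, tsum_fintype]
    rw [Finset.sum_coe_sort (Finset.powerset (0 : ℕ →₀ ℕ).support) (fun S => (-1 : ℂ) ^ S.card)]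
    simp
  · intro g hg
    simp only [hF, tsum_fintype]
    rw [← Finset.mul_sum,
      Finset.sum_coe_sort (Finset.powerset g.support) (fun S => (-1 : ℂ) ^ S.card)]
    have := Finset.sum_powerset_neg_one_pow_card (x := g.support)
    rw [if_neg (by simpa using hg)] at this
    have h3 : ∑ S ∈ g.support.powerset, (-1 : ℂ) ^ S.card = 0 := by exact_mod_cast this
    rw [h3, mul_zero]

lemma euler_exp (z : ℕ → ℂ) (hz : ∀ i, ‖z i‖ < 1)
    (hZ : Summable fun e : ℕ →₀ ℕ => ‖e.prod fun i k => z i ^ k‖) :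
    Summable (fun i => Complex.log (1 - z i)) ∧
    ∑' S : Finset ℕ, ∏ i ∈ S, (-z i) = Complex.exp (∑' i, Complex.log (1 - z i)) ∧
    (∑' e : ℕ →₀ ℕ, e.prod fun i k => z i ^ k) =
      Complex.exp (-∑' i, Complex.log (1 - z i)) := by
  obtain ⟨h1, h2, h3⟩ := euler z hZ
  have hs : Summable (fun i => Complex.log (1 - z i)) := by
    have := Complex.summable_log_one_add_of_summable (f := fun i => -z i) (by
      exact Summable.of_norm (by simpa using h1))
    simpa [sub_eq_add_neg] using this
  have hne : ∀ i, 1 - z i ≠ 0 := by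
    intro i h
    have := hz i
    rw [← sub_eq_zero.mp h] at this
    simp at this
  have he : ∑' S : Finset ℕ, ∏ i ∈ S, (-z i) = Complex.exp (∑' i, Complex.log (1 - z i)) := by
    rw [Complex.cexp_tsum_eq_tprod hne hs, ← tprod_one_add h2.of_norm]
    simp [sub_eq_add_neg]
  refine ⟨hs, he, ?_⟩
  rw [he] at h3
  rw [Complex.exp_neg]
  exact eq_inv_of_mul_eq_one_left h3

end BeurlingAux

namespace BeurlingAux
open Complex MeasureTheory Set Filter Topology Asymptotics

lemma p_gt (p : ℕ → ℝ) (hmono : Monotone p) (hp0 : 1 < p 0) (i : ℕ) : 1 < p i :=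
  hp0.trans_le (hmono (Nat.zero_le i))

/-- The generalized integer attached to `e`. -/
noncomputable def gi (p : ℕ → ℝ) (e : ℕ →₀ ℕ) : ℝ := e.prod fun i k => p i ^ k

lemma gi_one_le {p : ℕ → ℝ} (hp : ∀ i, 1 < p i) (e : ℕ →₀ ℕ) : 1 ≤ gi p e := by
  refine Finset.prod_induction _ (fun y : ℝ => 1 ≤ y) (fun a b ha hb => ?_) le_rfl ?_
  · nlinarith
  · intro i _
    exact one_le_pow₀ (hp i).le

lemma gi_ge {p : ℕ → ℝ} (hp : ∀ i, 1 < p i) (e : ℕ →₀ ℕ) (i : ℕ) : p i ^ e i ≤ gi p e := by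
  have h : gi p e = p i ^ e i * gi p (e.erase i) := by
    exact (Finsupp.mul_prod_erase' e i (fun i k => p i ^ k) (by simp)).symm
  rw [h]
  have h1 := gi_one_le hp (e.erase i)
  have h2 : 0 ≤ p i ^ e i := pow_nonneg (by linarith [hp i]) _
  nlinarith

lemma gi_fin {p : ℕ → ℝ} (hmono : Monotone p) (hp0 : 1 < p 0) (htop : Tendsto p atTop atTop)
    (x : ℝ) : {e | gi p e ≤ x}.Finite := by
  have hp := p_gt p hmono hp0
  obtain ⟨m, hm⟩ := (htop.eventually_gt_atTop x).exists_forall_of_atTop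
  obtain ⟨K, hK⟩ := pow_unbounded_of_one_lt x hp0
  refine (Set.finite_Iic (K • ind (Finset.range m))).subset ?_
  intro e he
  rw [Set.mem_Iic]
  intro i
  have he' : gi p e ≤ x := he
  have h1 := (gi_ge hp e i).trans he'
  rw [Finsupp.smul_apply, ind_apply]
  by_cases hi : i ∈ Finset.range m
  · rw [if_pos hi]
    simp only [smul_eq_mul, mul_one]
    by_contra hlt
    push Not at hlt
    have h3 : p 0 ^ K ≤ p i ^ e i :=
      calc p 0 ^ K ≤ p 0 ^ e i := pow_le_pow_right₀ hp0.le hlt.le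
        _ ≤ p i ^ e i := pow_le_pow_left₀ (by linarith) (hmono (Nat.zero_le i)) _
    linarith
  · rw [if_neg hi]
    simp only [Finset.mem_range, not_lt] at hi
    simp only [smul_zero, nonpos_iff_eq_zero]
    by_contra h0
    have h2 := hm i hi
    have h3 : p i ≤ p i ^ e i := le_self_pow₀ (hp i).le h0
    linarith

/-- prime powers -/
noncomputable def pp (p : ℕ → ℝ) (q : ℕ × ℕ) : ℝ := p q.1 ^ (q.2 + 1)

lemma pp_one_le {p : ℕ → ℝ} (hp : ∀ i, 1 < p i) (q : ℕ × ℕ) : 1 ≤ pp p q :=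
  one_le_pow₀ (hp q.1).le

lemma pp_fin {p : ℕ → ℝ} (hmono : Monotone p) (hp0 : 1 < p 0) (htop : Tendsto p atTop atTop)
    (x : ℝ) : {q | pp p q ≤ x}.Finite := by
  have hp := p_gt p hmono hp0
  have hinj : Function.Injective (fun q : ℕ × ℕ => Finsupp.single q.1 (q.2 + 1)) := by
    rintro ⟨a, b⟩ ⟨c, d⟩ h
    have := (Finsupp.single_eq_single_iff _ _ _ _).mp h
    simp at this
    ext <;> simp [this]
  have := (gi_fin hmono hp0 htop x).preimage hinj.injOn
  refine this.subset fun q hq => ?_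
  have hq' : pp p q ≤ x := hq
  change gi p (Finsupp.single q.1 (q.2 + 1)) ≤ x
  rw [gi, Finsupp.prod_single_index (by simp)]
  exact hq'

lemma NP_eq {p : ℕ → ℝ} (hmono : Monotone p) (hp0 : 1 < p 0) (htop : Tendsto p atTop atTop)
    (x : ℝ) : (NP p x : ℝ) = cnt (gi p) (fun _ => 1) x := by
  have hf := gi_fin hmono hp0 htop x
  rw [NP, cnt, finsum_mem_eq_finite_toFinset_sum _ hf, Finset.sum_const, nsmul_eq_mul, mul_one,
    Nat.card_coe_set_eq]
  change ((Set.ncard {e | gi p e ≤ x} : ℕ) : ℝ) = _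
  rw [Set.ncard_eq_toFinset_card _ hf]

lemma psiP_eq (p : ℕ → ℝ) (x : ℝ) : psiP p x = cnt (pp p) (fun q => Real.log (p q.1)) x := by
  rw [psiP, cnt]
  symm
  refine finsum_mem_eq_of_bijOn (fun q : ℕ × ℕ => (q.1, q.2 + 1)) ⟨?_, ?_, ?_⟩ ?_
  · intro q hq
    exact ⟨Nat.le_add_left _ _, hq⟩
  · rintro ⟨a, b⟩ _ ⟨c, d⟩ _ h
    simpa using h
  · rintro ⟨i, k⟩ ⟨h1, h2⟩
    simp only at h1 h2
    refine ⟨(i, k - 1), ?_, ?_⟩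
    · change p i ^ (k - 1 + 1) ≤ x
      rwa [Nat.sub_add_cancel h1]
    · simp only
      rw [Nat.sub_add_cancel h1]
  · intro q _
    rfl

/-- from asymptotic to uniform bounds -/
lemma unif_bound {F : ℝ → ℝ} (hF : Monotone F) (hF0 : ∀ x, 0 ≤ F x) {c κ : ℝ} (hκ : 0 ≤ κ)
    (h : (fun x => F x - c * x) =O[atTop] fun x : ℝ => x ^ κ) :
    ∃ C, 0 ≤ C ∧ ∀ x, 1 ≤ x → |F x - c * x| ≤ C * x ^ κ := by
  obtain ⟨C₁, hC₁⟩ := h.bound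
  obtain ⟨X, hX⟩ := hC₁.exists_forall_of_atTop
  refine ⟨max C₁ 0 + (F X + |c| * |X|), ?_, fun x hx => ?_⟩
  · have := hF0 X
    positivity
  have hxk : 1 ≤ x ^ κ := Real.one_le_rpow hx hκ
  have hnn : 0 ≤ F X + |c| * |X| := by
    have := hF0 X
    positivity
  rcases le_total X x with hle | hle
  · have h1 := hX x hle
    rw [Real.norm_eq_abs, Real.norm_of_nonneg (by linarith)] at h1
    have := le_max_left C₁ 0
    nlinarith
  · have h1 : |F x - c * x| ≤ F X + |c| * |X| := by
      refine (abs_sub _ _).trans ?_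
      rw [abs_mul, abs_of_nonneg (hF0 x)]
      have : |x| ≤ |X| := by
        rw [abs_of_nonneg (by linarith : 0 ≤ x), abs_of_nonneg (by linarith : 0 ≤ X)]
        exact hle
      have h3 := hF hle
      gcongr
    have := le_max_right C₁ 0
    nlinarith [mul_nonneg this (by linarith : 0 ≤ x ^ κ)]

end BeurlingAux

namespace BeurlingAux
open Complex MeasureTheory Set Filter Topology Asymptotics

lemma pow_ofReal_cpow {x : ℝ} (hx : 0 ≤ x) (n : ℕ) (w : ℂ) :
    ((x ^ n : ℝ) : ℂ) ^ w = ((x : ℂ) ^ w) ^ n := by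
  induction n with
  | zero => simp
  | succ n ih =>
    rw [pow_succ, pow_succ, ofReal_mul, mul_cpow_ofReal_nonneg (pow_nonneg hx n) hx, ih]

lemma prod_ofReal_cpow {T : Finset ℕ} {x : ℕ → ℝ} (hx : ∀ i, 0 ≤ x i) (w : ℂ) :
    ((∏ i ∈ T, x i : ℝ) : ℂ) ^ w = ∏ i ∈ T, (x i : ℂ) ^ w := by
  induction T using Finset.induction_on with
  | empty => simp
  | insert i T hi ih =>
    rw [Finset.prod_insert hi, Finset.prod_insert hi, ofReal_mul,
      mul_cpow_ofReal_nonneg (hx i) (Finset.prod_nonneg fun i _ => hx i), ih]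

lemma gi_cpow {p : ℕ → ℝ} (hp : ∀ i, 1 < p i) (e : ℕ →₀ ℕ) (w : ℂ) :
    (gi p e : ℂ) ^ w = e.prod fun i k => ((p i : ℂ) ^ w) ^ k := by
  rw [gi, Finsupp.prod, prod_ofReal_cpow (x := fun i => p i ^ e i)
    (fun i => pow_nonneg (by linarith [hp i]) _), Finsupp.prod]
  exact Finset.prod_congr rfl fun i _ => pow_ofReal_cpow (by linarith [hp i]) _ _

lemma pp_cpow {p : ℕ → ℝ} (hp : ∀ i, 1 < p i) (q : ℕ × ℕ) (w : ℂ) :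
    (pp p q : ℂ) ^ w = ((p q.1 : ℂ) ^ w) ^ (q.2 + 1) :=
  pow_ofReal_cpow (by linarith [hp q.1]) _ _

/-- logarithm of zeta -/
noncomputable def Lz (p : ℕ → ℝ) (s : ℂ) : ℂ :=
  ∑' q : ℕ × ℕ, (1 / ((q.2 : ℂ) + 1)) * (pp p q : ℂ) ^ (-s)

lemma Lz_term_norm {p : ℕ → ℝ} (hmono : Monotone p) (hp0 : 1 < p 0) (q : ℕ × ℕ) (s : ℂ) :
    ‖(1 / ((q.2 : ℂ) + 1)) * (pp p q : ℂ) ^ (-s)‖ ≤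
      (Real.log (p 0))⁻¹ * (Real.log (p q.1) * pp p q ^ (-s.re)) := by
  have hp := p_gt p hmono hp0
  have h1 := pp_one_le hp q
  have hl0 : 0 < Real.log (p 0) := Real.log_pos hp0
  have hl : Real.log (p 0) ≤ Real.log (p q.1) :=
    Real.log_le_log (by linarith) (hmono (Nat.zero_le _))
  rw [norm_mul, norm_cpow_eq_rpow_re_of_pos (by linarith), neg_re, ← mul_assoc]
  gcongr
  have h2 : ‖(1 / ((q.2 : ℂ) + 1))‖ ≤ 1 := by
    rw [norm_div, norm_one]
    have : ‖(q.2 : ℂ) + 1‖ = (q.2 : ℝ) + 1 := by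
      rw [show (q.2 : ℂ) + 1 = (((q.2 + 1 : ℕ)) : ℂ) by push_cast; rfl, norm_natCast]
      push_cast; rfl
    rw [this]
    exact (div_le_one (by positivity)).mpr (by linarith [(Nat.cast_nonneg q.2 : (0:ℝ) ≤ q.2)])
  refine h2.trans ?_
  rw [inv_mul_eq_div, one_le_div hl0]
  exact hl

lemma Lz_summable {p : ℕ → ℝ} (hmono : Monotone p) (hp0 : 1 < p 0)
    (hsum : ∀ σ : ℝ, 1 < σ → Summable (fun q : ℕ × ℕ => Real.log (p q.1) * pp p q ^ (-σ)))
    {s : ℂ} (hs : 1 < s.re) :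
    Summable (fun q : ℕ × ℕ => ‖(1 / ((q.2 : ℂ) + 1)) * (pp p q : ℂ) ^ (-s)‖) :=
  Summable.of_nonneg_of_le (fun _ => norm_nonneg _) (fun q => Lz_term_norm hmono hp0 q s)
    ((hsum s.re hs).mul_left _)

lemma Lz_bdd {p : ℕ → ℝ} (hmono : Monotone p) (hp0 : 1 < p 0)
    (hsum : ∀ σ : ℝ, 1 < σ → Summable (fun q : ℕ × ℕ => Real.log (p q.1) * pp p q ^ (-σ))) :
    ∃ B, 0 ≤ B ∧ ∀ s : ℂ, s.re = 2 → ‖Lz p s‖ ≤ B := by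
  refine ⟨∑' q : ℕ × ℕ, (Real.log (p 0))⁻¹ * (Real.log (p q.1) * pp p q ^ (-(2:ℝ))), ?_, ?_⟩
  · refine tsum_nonneg fun q => ?_
    exact (norm_nonneg _).trans (Lz_term_norm hmono hp0 q ((2 : ℝ) : ℂ))
  · intro s hs
    refine tsum_of_norm_bounded ((hsum 2 (by norm_num)).mul_left _).hasSum fun q => ?_
    rw [← hs]
    exact Lz_term_norm hmono hp0 q s

lemma Lz_deriv {p : ℕ → ℝ} (hmono : Monotone p) (hp0 : 1 < p 0)
    (hsum : ∀ σ : ℝ, 1 < σ → Summable (fun q : ℕ × ℕ => Real.log (p q.1) * pp p q ^ (-σ)))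
    {s : ℂ} (hs : 1 < s.re) :
    HasDerivAt (Lz p) (-∑' q : ℕ × ℕ, ((Real.log (p q.1) : ℝ) : ℂ) * (pp p q : ℂ) ^ (-s)) s := by
  have hp := p_gt p hmono hp0
  obtain ⟨σ, h1, h2⟩ := exists_between hs
  rw [← tsum_neg]
  refine hasDerivAt_tsum_of_isPreconnected (t := {z : ℂ | σ < z.re}) (hsum σ h1)
    (isOpen_lt continuous_const continuous_re)
    (convex_halfSpace_re_gt σ).isPreconnected (y₀ := s)
    (g' := fun q y => -(((Real.log (p q.1) : ℝ) : ℂ) * (pp p q : ℂ) ^ (-y))) ?_ ?_ h2 ?_ h2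
  · intro q y _
    have hpp := pp_one_le hp q
    have hne : (pp p q : ℂ) ≠ 0 := by
      have : 0 < pp p q := by linarith
      exact_mod_cast this.ne'
    have hd := (((hasDerivAt_id y).neg).const_cpow (c := (pp p q : ℂ)) (Or.inl hne)).const_mul
      (1 / ((q.2 : ℂ) + 1))
    have hlog : Complex.log (pp p q : ℂ) = (q.2 + 1) * ((Real.log (p q.1) : ℝ) : ℂ) := by
      rw [← ofReal_log (by linarith), pp, Real.log_pow]
      push_cast; rfl
    rw [hlog] at hd
    have hk : (q.2 : ℂ) + 1 ≠ 0 := by exact_mod_cast Nat.succ_ne_zero q.2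
    refine hd.congr_deriv ?_
    simp only [Pi.neg_apply, id]
    field_simp
  · intro q y hy
    have hpp := pp_one_le hp q
    have hl0 : 0 ≤ Real.log (p q.1) := Real.log_nonneg (hp q.1).le
    rw [norm_neg, norm_mul, norm_cpow_eq_rpow_re_of_pos (by linarith), norm_real,
      Real.norm_of_nonneg hl0, neg_re]
    have hy' : σ < y.re := hy
    gcongr
  · exact (Lz_summable hmono hp0 hsum hs).of_norm

lemma Lz_exp {p : ℕ → ℝ} (hmono : Monotone p) (hp0 : 1 < p 0)
    (hsum : ∀ σ : ℝ, 1 < σ → Summable (fun q : ℕ × ℕ => Real.log (p q.1) * pp p q ^ (-σ)))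
    (hsumZ : ∀ σ : ℝ, 1 < σ → Summable (fun e : ℕ →₀ ℕ => gi p e ^ (-σ)))
    {s : ℂ} (hs : 1 < s.re) :
    (∑' e : ℕ →₀ ℕ, (gi p e : ℂ) ^ (-s)) = Complex.exp (Lz p s) ∧
    Summable (fun S : Finset ℕ => (∏ i ∈ S, p i) ^ (-s.re)) ∧
    HasSum (fun S : Finset ℕ => (-1 : ℂ) ^ S.card * ((∏ i ∈ S, p i : ℝ) : ℂ) ^ (-s))
      (Complex.exp (-Lz p s)) := by
  have hp := p_gt p hmono hp0
  set z : ℕ → ℂ := fun i => (p i : ℂ) ^ (-s) with hz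
  have hzn : ∀ i, ‖z i‖ = p i ^ (-s.re) := fun i => by
    rw [hz, norm_cpow_eq_rpow_re_of_pos (by linarith [hp i]), neg_re]
  have hz1 : ∀ i, ‖z i‖ < 1 := fun i => by
    rw [hzn]
    exact Real.rpow_lt_one_of_one_lt_of_neg (hp i) (by linarith)
  have hZ : Summable fun e : ℕ →₀ ℕ => ‖e.prod fun i k => z i ^ k‖ := by
    refine (hsumZ s.re hs).congr fun e => ?_
    rw [← gi_cpow hp, norm_cpow_eq_rpow_re_of_pos (by linarith [gi_one_le hp e]), neg_re]
  obtain ⟨h1, h2, h3⟩ := euler_exp z hz1 hZ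
  obtain ⟨-, h5, -⟩ := euler z hZ
  have hL : Lz p s = -∑' i, Complex.log (1 - z i) := by
    rw [Lz, (Lz_summable hmono hp0 hsum hs).of_norm.tsum_prod, ← tsum_neg]
    refine tsum_congr fun i => ?_
    have h6 := Complex.hasSum_taylorSeries_neg_log (hz1 i)
    have h7 := (hasSum_nat_add_iff' 1).mpr h6
    simp only [Finset.range_one, Finset.sum_singleton, pow_zero, CharP.cast_eq_zero, div_zero,
      sub_zero] at h7
    rw [← h7.tsum_eq]
    refine tsum_congr fun k => ?_
    rw [pp_cpow hp]
    push_cast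
    ring
  refine ⟨?_, ?_, ?_⟩
  · rw [hL, ← h3]
    exact tsum_congr fun e => gi_cpow hp e _
  · refine h5.congr fun S => ?_
    rw [norm_prod]
    simp only [norm_neg, hzn]
    exact Real.finsetProd_rpow _ _ (fun i _ => by linarith [hp i]) _
  · rw [hL, neg_neg, ← h2]
    have h8 := h5.of_norm.hasSum
    have hf : (fun S : Finset ℕ => (-1 : ℂ) ^ S.card * ((∏ i ∈ S, p i : ℝ) : ℂ) ^ (-s)) =
        fun S => ∏ i ∈ S, (-z i) := by
      funext S
      rw [prod_ofReal_cpow (fun i => by linarith [hp i]), Finset.prod_neg]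
    rw [hf]
    exact h8

end BeurlingAux

namespace BeurlingAux
open Complex MeasureTheory Set Filter Topology Asymptotics

lemma log_ratio_bdd {s : ℂ} (hs : s.re = 2) :
    ‖Complex.log (s - 1) - Complex.log (s + 1)‖ ≤ Real.log 3 + 2 * Real.pi := by
  have h1 : 1 ≤ ‖s - 1‖ := by
    have := re_le_norm (s - 1)
    simp [hs] at this
    linarith
  have h2 : 1 ≤ ‖s + 1‖ := by
    have := re_le_norm (s + 1)
    simp [hs] at this
    linarith
  have h3 : ‖s + 1‖ ≤ 3 * ‖s - 1‖ := by
    have h := norm_add_le (s - 1) 2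
    rw [show s - 1 + 2 = s + 1 by ring] at h
    simp at h
    linarith
  have h4 : ‖s - 1‖ ≤ 3 * ‖s + 1‖ := by
    have h := norm_sub_le (s + 1) 2
    rw [show s + 1 - 2 = s - 1 by ring] at h
    simp at h
    linarith
  have h5 : Real.log ‖s + 1‖ ≤ Real.log 3 + Real.log ‖s - 1‖ := by
    rw [← Real.log_mul (by norm_num) (by linarith)]
    exact Real.log_le_log (by linarith) h3
  have h6 : Real.log ‖s - 1‖ ≤ Real.log 3 + Real.log ‖s + 1‖ := by
    rw [← Real.log_mul (by norm_num) (by linarith)]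
    exact Real.log_le_log (by linarith) h4
  refine (Complex.norm_le_abs_re_add_abs_im _).trans ?_
  simp only [sub_re, sub_im, log_re, log_im]
  have h7 := abs_arg_le_pi (s - 1)
  have h8 := abs_arg_le_pi (s + 1)
  have h9 := abs_sub (arg (s - 1)) (arg (s + 1))
  have h10 : |Real.log ‖s - 1‖ - Real.log ‖s + 1‖| ≤ Real.log 3 := by
    rw [abs_le]; constructor <;> linarith
  linarith

theorem H_exists {p : ℕ → ℝ} (hmono : Monotone p) (hp0 : 1 < p 0) (htop : Tendsto p atTop atTop)
    {κ ρ C₁ C₂ : ℝ} (hκ0 : 0 < κ) (hκ1 : κ < 1) (hρ : 0 < ρ) (hC₁ : 0 ≤ C₁) (hC₂ : 0 ≤ C₂)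
    (h1 : ∀ x, 1 ≤ x → |cnt (pp p) (fun q => Real.log (p q.1)) x - 1 * x| ≤ C₁ * x ^ κ)
    (h2 : ∀ x, 1 ≤ x → |cnt (gi p) (fun _ => 1) x - ρ * x| ≤ C₂ * x ^ κ) :
    ∃ H : ℂ → ℂ, (∀ s, κ < s.re → DifferentiableAt ℂ H s) ∧
      (∀ s : ℂ, 1 < s.re → Summable (fun S : Finset ℕ => (∏ i ∈ S, p i) ^ (-s.re)) ∧
        HasSum (fun S : Finset ℕ => (-1 : ℂ) ^ S.card * ((∏ i ∈ S, p i : ℝ) : ℂ) ^ (-s))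
          ((s - 1) / (s + 1) * Complex.exp (-H s))) ∧
      (∃ B, 0 ≤ B ∧ ∀ s : ℂ, s.re = 2 → ‖H s‖ ≤ B) ∧
      (∀ κ₁, κ < κ₁ → ∃ C, 1 ≤ C ∧ ∀ s : ℂ, κ₁ < s.re → (H s).re ≤ Real.log (C * (‖s‖ + 1))) := by
  have hp := p_gt p hmono hp0
  obtain ⟨E, Ed, -, Es⟩ := dirichlet_cont (pp_one_le hp)
    (fun q => Real.log_nonneg (hp q.1).le) (pp_fin hmono hp0 htop) hC₁ hκ1 h1
  obtain ⟨F, Fd, Fb, Fs⟩ := dirichlet_cont (gi_one_le hp)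
    (fun q => zero_le_one) (gi_fin hmono hp0 htop) hC₂ hκ1 h2
  have hsum : ∀ σ : ℝ, 1 < σ →
      Summable (fun q : ℕ × ℕ => Real.log (p q.1) * pp p q ^ (-σ)) := fun σ hσ => by
    simpa using (Es (σ : ℂ) (by simpa using hσ)).1
  have hsumZ : ∀ σ : ℝ, 1 < σ → Summable (fun e : ℕ →₀ ℕ => gi p e ^ (-σ)) := fun σ hσ => by
    simpa using (Fs (σ : ℂ) (by simpa using hσ)).1
  set f : ℂ → ℂ := fun s => -(s * E s) - 1 - 1 / (s + 1) with hf
  have hne1 : ∀ s : ℂ, κ < s.re → s + 1 ≠ 0 := by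
    intro s hs h
    have := congrArg re h
    simp at this
    linarith
  have hfd : DifferentiableOn ℂ f {s | κ < s.re} := by
    intro s hs
    have hE := Ed s hs
    have := hne1 s hs
    apply DifferentiableAt.differentiableWithinAt
    have h3 : DifferentiableAt ℂ (fun s : ℂ => 1 / (s + 1)) s :=
      (differentiableAt_const _).div (by fun_prop) this
    exact (((differentiableAt_id.mul hE).neg).sub_const 1).sub h3
  obtain ⟨g, hg⟩ := halfplane_primitive κ f hfd
  set Λ : ℂ → ℂ := fun s => Lz p s + (Complex.log (s - 1) - Complex.log (s + 1)) with hΛ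
  have hΛd : ∀ s : ℂ, 1 < s.re → HasDerivAt Λ (f s) s := by
    intro s hs
    have ha := Lz_deriv hmono hp0 hsum hs
    rw [(Es s hs).2.tsum_eq] at ha
    have hb : HasDerivAt (fun s : ℂ => Complex.log (s - 1)) (1 / (s - 1)) s :=
      ((hasDerivAt_id s).sub_const 1).clog (by left; simp; linarith)
    have hc : HasDerivAt (fun s : ℂ => Complex.log (s + 1)) (1 / (s + 1)) s :=
      ((hasDerivAt_id s).add_const 1).clog (by left; simp; linarith)
    refine (ha.add (hb.sub hc)).congr_deriv ?_
    have h3 : s - 1 ≠ 0 := by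
      intro h
      have := congrArg re h
      simp at this
      linarith
    have h4 := hne1 s (by linarith)
    simp only [hf]
    push_cast
    field_simp
    ring
  set H : ℂ → ℂ := fun s => g s + (Λ 2 - g 2) with hH
  have hHd : ∀ s, κ < s.re → HasDerivAt H (f s) s := fun s hs => (hg s hs).add_const _
  have hopen : ∀ a : ℝ, IsOpen {s : ℂ | a < s.re} := fun a =>
    isOpen_lt continuous_const continuous_re
  have hpre : ∀ a : ℝ, IsPreconnected {s : ℂ | a < s.re} := fun a =>
    (convex_halfSpace_re_gt a).isPreconnected
  have hHΛ : ∀ s : ℂ, 1 < s.re → H s = Λ s := by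
    intro s hs
    refine (hopen 1).eqOn_of_deriv_eq (hpre 1)
      (fun s hs => ((hHd s (hκ1.trans hs)).differentiableAt).differentiableWithinAt)
      (fun s hs => ((hΛd s hs).differentiableAt).differentiableWithinAt)
      (fun s hs => by rw [(hHd s (hκ1.trans hs)).deriv, (hΛd s hs).deriv])
      (x := 2) (by simp) (by simp [hH]) hs
  have hexp : ∀ s : ℂ, 1 < s.re → Complex.exp (H s) =
      Complex.exp (Lz p s) * ((s - 1) / (s + 1)) := by
    intro s hs
    have h3 : s - 1 ≠ 0 := by
      intro h
      have := congrArg re h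
      simp at this
      linarith
    have h4 := hne1 s (by linarith)
    rw [hHΛ s hs, hΛ]
    simp only
    rw [Complex.exp_add, Complex.exp_sub, Complex.exp_log h3, Complex.exp_log h4]
  have hident : ∀ s : ℂ, κ < s.re →
      Complex.exp (H s) * (s + 1) = s * (s - 1) * F s + ρ * s := by
    have hA : AnalyticOnNhd ℂ (fun s => Complex.exp (H s) * (s + 1)) {s | κ < s.re} := by
      apply DifferentiableOn.analyticOnNhd _ (hopen κ)
      intro s hs
      apply DifferentiableAt.differentiableWithinAt
      have := (hHd s hs).differentiableAt
      fun_prop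
    have hB : AnalyticOnNhd ℂ (fun s => s * (s - 1) * F s + ρ * s) {s | κ < s.re} := by
      apply DifferentiableOn.analyticOnNhd _ (hopen κ)
      intro s hs
      apply DifferentiableAt.differentiableWithinAt
      have := Fd s hs
      fun_prop
    have h2' : (2 : ℂ) ∈ {s : ℂ | κ < s.re} := by
      change κ < (2 : ℂ).re
      simp; linarith
    intro s hs
    refine hA.eqOn_of_preconnected_of_eventuallyEq hB (hpre κ) h2' ?_ hs
    filter_upwards [(hopen 1).mem_nhds (show (2:ℂ) ∈ {s : ℂ | 1 < s.re} by simp)] with s hs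
    have hs' : 1 < s.re := hs
    have h3 : s - 1 ≠ 0 := by
      intro h
      have := congrArg re h
      simp at this
      linarith
    have h4 := hne1 s (by linarith)
    have h5 := (Fs s hs').2.tsum_eq
    simp only [ofReal_one, one_mul] at h5
    rw [hexp s hs', ← (Lz_exp hmono hp0 hsum hsumZ hs').1, h5]
    field_simp
  refine ⟨H, fun s hs => (hHd s hs).differentiableAt, ?_, ?_, ?_⟩
  · intro s hs
    obtain ⟨-, h3, h4⟩ := Lz_exp hmono hp0 hsum hsumZ hs
    refine ⟨h3, ?_⟩
    have h5 : (s - 1) / (s + 1) * Complex.exp (-H s) = Complex.exp (-Lz p s) := by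
      have h6 : s - 1 ≠ 0 := by
        intro h
        have := congrArg re h
        simp at this
        linarith
      have h4 := hne1 s (by linarith)
      rw [Complex.exp_neg, Complex.exp_neg, hexp s hs]
      have := Complex.exp_ne_zero (Lz p s)
      field_simp
    rw [h5]
    exact h4
  · obtain ⟨B, hB0, hB⟩ := Lz_bdd hmono hp0 hsum
    refine ⟨B + (Real.log 3 + 2 * Real.pi), ?_, fun s hs => ?_⟩
    · have := Real.pi_pos
      have := Real.log_nonneg (show (1:ℝ) ≤ 3 by norm_num)
      positivity
    · rw [hHΛ s (by linarith)]
      exact (norm_add_le _ _).trans (add_le_add (hB s hs) (log_ratio_bdd hs))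
  · intro κ₁ hκ₁
    have hq : 0 ≤ C₂ / (κ₁ - κ) := div_nonneg hC₂ (by linarith)
    refine ⟨C₂ / (κ₁ - κ) + ρ + 1, by linarith, fun s hs => ?_⟩
    have hsκ : κ < s.re := by linarith
    rw [Real.le_log_iff_exp_le (by positivity), ← Complex.norm_exp]
    have h3 := congrArg norm (hident s hsκ)
    rw [norm_mul] at h3
    have h4 : ‖s‖ ≤ ‖s + 1‖ := by
      rw [Complex.norm_def, Complex.norm_def]
      apply Real.sqrt_le_sqrt
      simp only [normSq_apply, add_re, one_re, add_im, one_im]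
      nlinarith
    have h5 : 0 < ‖s + 1‖ := norm_pos_iff.mpr (hne1 s hsκ)
    have h6 : ‖F s‖ ≤ C₂ / (κ₁ - κ) := by
      refine (Fb s hsκ).trans ?_
      gcongr
    have h7 : ‖s - 1‖ ≤ ‖s‖ + 1 := by simpa using norm_sub_le s 1
    have h8 : ‖s * (s - 1) * F s + ρ * s‖ ≤
        ‖s + 1‖ * ((C₂ / (κ₁ - κ) + ρ + 1) * (‖s‖ + 1)) := by
      calc ‖s * (s - 1) * F s + ρ * s‖ ≤ ‖s‖ * ‖s - 1‖ * ‖F s‖ + ρ * ‖s‖ := by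
            refine (norm_add_le _ _).trans ?_
            rw [norm_mul, norm_mul, norm_mul, norm_real, Real.norm_of_nonneg hρ.le]
        _ ≤ ‖s + 1‖ * (‖s‖ + 1) * (C₂ / (κ₁ - κ)) + ρ * ‖s + 1‖ := by gcongr
        _ ≤ _ := by
            have h9 := norm_nonneg s
            have : 0 ≤ ‖s + 1‖ * (‖s‖ + 1 + ρ * ‖s‖) := by positivity
            nlinarith
    rw [← h3, mul_comm] at h8
    exact le_of_mul_le_mul_left h8 h5

end BeurlingAux

namespace BeurlingAux
open Complex MeasureTheory Set Filter Topology Asymptotics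

lemma bracket_bound {n x w : ℝ} (hw : |w| = 1) :
    |w * (max (x + 1 - n) 0 - max (x - n) 0) - (Ici n).indicator (fun _ => w) x| ≤
      (Ici n).indicator (fun _ => (1:ℝ)) (x + 1) - (Ici n).indicator (fun _ => (1:ℝ)) x := by
  by_cases h1 : n ≤ x
  · rw [indicator_of_mem (mem_Ici.mpr h1), indicator_of_mem (mem_Ici.mpr h1),
      indicator_of_mem (mem_Ici.mpr (by linarith)), max_eq_left (by linarith),
      max_eq_left (by linarith)]
    ring_nf
    simp
  · push Not at h1
    have hx : x ∉ Ici n := by simpa using h1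
    rw [indicator_of_notMem hx, indicator_of_notMem hx,
      max_eq_right (a := x - n) (by linarith), sub_zero, sub_zero, sub_zero, abs_mul, hw, one_mul,
      abs_of_nonneg (le_max_right _ _)]
    by_cases h2 : n ≤ x + 1
    · rw [indicator_of_mem (mem_Ici.mpr h2)]
      exact max_le (by linarith) zero_le_one
    · push Not at h2
      rw [indicator_of_notMem (by simpa using h2)]
      exact max_le (by linarith) le_rfl

lemma ind_gi (p : ℕ → ℝ) (S : Finset ℕ) : gi p (ind S) = ∏ i ∈ S, p i := ind_prod p S

lemma M_approx {p : ℕ → ℝ} (hmono : Monotone p) (hp0 : 1 < p 0) (htop : Tendsto p atTop atTop)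
    {x : ℝ} {v : ℂ}
    (hv : HasSum (fun S : Finset ℕ => (-1 : ℂ) ^ S.card *
      ((max (x + 1 - ∏ i ∈ S, p i) 0 - max (x - ∏ i ∈ S, p i) 0 : ℝ) : ℂ)) v) :
    ‖v - MP p x‖ ≤ cnt (gi p) (fun _ => 1) (x + 1) - cnt (gi p) (fun _ => 1) x := by
  have hfinS : ∀ y, {S : Finset ℕ | ∏ i ∈ S, p i ≤ y}.Finite := by
    intro y
    refine ((gi_fin hmono hp0 htop y).preimage ind_inj.injOn).subset fun S hS => ?_
    change gi p (ind S) ≤ y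
    rw [ind_gi]
    exact hS
  have hM : HasSum (fun S : Finset ℕ =>
      (Ici (∏ i ∈ S, p i)).indicator (fun _ => (-1 : ℝ) ^ S.card) x) (MP p x) :=
    cnt_hasSum (a := fun S : Finset ℕ => ∏ i ∈ S, p i) (w := fun S => (-1 : ℝ) ^ S.card) hfinS x
  have hQ := (cnt_hasSum (a := fun S : Finset ℕ => ∏ i ∈ S, p i) (w := fun _ => (1 : ℝ)) hfinS
    (x + 1)).sub (cnt_hasSum (a := fun S : Finset ℕ => ∏ i ∈ S, p i) (w := fun _ => (1 : ℝ)) hfinS x)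
  have hN := (cnt_hasSum (w := fun _ => (1 : ℝ)) (gi_fin hmono hp0 htop) (x + 1)).sub
    (cnt_hasSum (w := fun _ => (1 : ℝ)) (gi_fin hmono hp0 htop) x)
  have hQN := hasSum_le_inj ind ind_inj (fun e _ => ?_) (fun S => ?_) hQ hN
  · refine le_trans ?_ hQN
    have hd := hv.sub (Complex.hasSum_ofReal.mpr hM)
    refine hd.norm_le_of_bounded hQ fun S => ?_
    have hb := bracket_bound (n := ∏ i ∈ S, p i) (x := x) (w := (-1 : ℝ) ^ S.card) (by simp)
    refine le_trans (le_of_eq ?_) hb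
    rw [← Real.norm_eq_abs, ← Complex.norm_real]
    push_cast
    rfl
  · rw [sub_nonneg]
    by_cases h : gi p e ≤ x
    · rw [indicator_of_mem (mem_Ici.mpr h), indicator_of_mem (mem_Ici.mpr (by linarith))]
    · rw [indicator_of_notMem (by simpa using h)]
      exact indicator_nonneg (fun _ _ => zero_le_one) _
  · rw [ind_gi]

lemma norm_ratio_le {s : ℂ} (hs : 0 ≤ s.re) (h1 : s + 1 ≠ 0) : ‖(s - 1) / (s + 1)‖ ≤ 1 := by
  rw [norm_div, div_le_one (norm_pos_iff.mpr h1), Complex.norm_def, Complex.norm_def]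
  apply Real.sqrt_le_sqrt
  simp only [normSq_apply, add_re, one_re, add_im, one_im, sub_re, sub_im]
  nlinarith

theorem main_bound {p : ℕ → ℝ} (hmono : Monotone p) (hp0 : 1 < p 0) (htop : Tendsto p atTop atTop)
    {κ ρ C₁ C₂ η : ℝ} (hκ0 : 0 < κ) (hη : 0 < η) (hη1 : η ≤ 1 / 4) (hκ1 : κ + 3 * η < 1) (hρ : 0 < ρ)
    (hC₁ : 0 ≤ C₁) (hC₂ : 0 ≤ C₂)
    (h1 : ∀ x, 1 ≤ x → |cnt (pp p) (fun q => Real.log (p q.1)) x - 1 * x| ≤ C₁ * x ^ κ)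
    (h2 : ∀ x, 1 ≤ x → |cnt (gi p) (fun _ => 1) x - ρ * x| ≤ C₂ * x ^ κ) :
    ∃ K, ∀ x, 1 ≤ x → |MP p x| ≤ K * x ^ (κ + 5 * η) := by
  have hp := p_gt p hmono hp0
  obtain ⟨H, Hd, Hs, ⟨B, hB0, hB⟩, Hre⟩ :=
    H_exists hmono hp0 htop hκ0 (by linarith) hρ hC₁ hC₂ h1 h2
  obtain ⟨C, hC1, hC⟩ := Hre (κ + η) (by linarith)
  obtain ⟨A, hA0, hA⟩ := log_growth (κ₁ := κ + η) (σ₁ := κ + 2 * η) (by linarith) (by linarith)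
    hC1 hB0 H (fun s hs => Hd s (by linarith)) hC hB
  obtain ⟨K₀, hK₀⟩ := sublog_growth (σ₁ := κ + 2 * η) (σ₀ := κ + 3 * η) (by linarith) (by linarith)
    (by linarith) hA0 hB0 hη H (fun s hs => Hd s (by linarith)) hA hB
  have hn : ∀ S : Finset ℕ, 1 ≤ ∏ i ∈ S, p i := fun S => by
    rw [← ind_gi]; exact gi_one_le hp _
  have hne1 : ∀ s : ℂ, κ + 3 * η ≤ s.re → s + 1 ≠ 0 := by
    intro s hs h
    have := congrArg re h
    simp at this
    linarith
  obtain ⟨K, hK0, hK⟩ := perron_bound (J := Finset ℕ) (n := fun S => ∏ i ∈ S, p i)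
    (c := fun S => (-1 : ℂ) ^ S.card) hn
    (D := fun s => (s - 1) / (s + 1) * Complex.exp (-H s)) (by
      have := (Hs ((2:ℝ) : ℂ) (by simp)).1
      simpa using this)
    (fun y => (Hs ((2:ℝ) + y * I) (by simp)).2)
    (σ₀ := κ + 3 * η) (δ := η) (C := Real.exp K₀) (by linarith) (by linarith) hη hη1
    (Real.exp_pos _).le (by
      intro s hs
      have h3 := Hd s (by linarith)
      have h4 := hne1 s hs
      have h5 : DifferentiableAt ℂ (fun s : ℂ => (s - 1) / (s + 1)) s :=
        DifferentiableAt.div (by fun_prop) (by fun_prop) h4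
      exact h5.mul h3.neg.cexp) (by
      intro s hs hs2
      rw [norm_mul]
      have h3 := norm_ratio_le (by linarith) (hne1 s hs)
      have h4 : ‖Complex.exp (-H s)‖ ≤ Real.exp K₀ * (|s.im| + 3) ^ η := by
        rw [Complex.norm_exp, Real.rpow_def_of_pos (by positivity), ← Real.exp_add]
        apply Real.exp_le_exp.mpr
        have h5 := hK₀ s hs hs2
        have h6 := re_le_norm (-H s)
        rw [norm_neg] at h6
        linarith
      calc _ ≤ 1 * ‖Complex.exp (-H s)‖ := by gcongr
        _ ≤ _ := by rw [one_mul]; exact h4)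
  refine ⟨(K + (ρ + 2 * C₂)) * 2 ^ (κ + 5 * η), fun x hx => ?_⟩
  obtain ⟨v, hv1, hv2⟩ := hK x hx
  rw [show κ + 3 * η + 2 * η = κ + 5 * η by ring] at hv1
  have h3 := M_approx hmono hp0 htop hv2
  have h4 := h2 x hx
  have h5 := h2 (x + 1) (by linarith)
  rw [abs_le] at h4 h5
  have h6 : x ^ κ ≤ (x + 1) ^ (κ + 5 * η) := by
    calc x ^ κ ≤ (x + 1) ^ κ := by gcongr; linarith
      _ ≤ _ := Real.rpow_le_rpow_of_exponent_le (by linarith) (by linarith)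
  have h7 : (x + 1) ^ κ ≤ (x + 1) ^ (κ + 5 * η) :=
    Real.rpow_le_rpow_of_exponent_le (by linarith) (by linarith)
  have h8 : 1 ≤ (x + 1) ^ (κ + 5 * η) := Real.one_le_rpow (by linarith) (by linarith)
  have h9 : (x + 1) ^ (κ + 5 * η) ≤ 2 ^ (κ + 5 * η) * x ^ (κ + 5 * η) := by
    rw [← Real.mul_rpow (by norm_num) (by linarith)]
    gcongr
    linarith
  have h10 : |MP p x| ≤ ‖v‖ + ‖v - MP p x‖ := by
    rw [← Real.norm_eq_abs, ← Complex.norm_real]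
    have := norm_sub_le v (v - MP p x)
    simpa using this
  have h11 : |MP p x| ≤ (K + (ρ + 2 * C₂)) * (x + 1) ^ (κ + 5 * η) := by
    nlinarith [mul_le_mul_of_nonneg_left h6 hC₂, mul_le_mul_of_nonneg_left h7 hC₂]
  refine h11.trans ?_
  rw [mul_assoc]
  have : 0 ≤ K + (ρ + 2 * C₂) := by positivity
  gcongr

end BeurlingAux

theorem stmt1 (p : ℕ → ℝ) (hmono : Monotone p) (hp0 : 1 < p 0)
    (htop : Tendsto p atTop atTop) (ρ : ℝ) (hρ : 0 < ρ)
    (α β : ℝ) (hα : α ∈ Set.Ico (0:ℝ) 1) (hβ : β ∈ Set.Ico (0:ℝ) 1)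
    (hψ : ∀ ε > 0, (fun x => psiP p x - x) =O[atTop] fun x => x ^ (α + ε))
    (hN : ∀ ε > 0, (fun x => (NP p x : ℝ) - ρ * x) =O[atTop] fun x => x ^ (β + ε)) :
    ∀ ε > 0, (fun x => MP p x) =O[atTop] fun x => x ^ (max α β + ε) := by
  intro ε hε
  have hp := BeurlingAux.p_gt p hmono hp0
  set Θ := max α β with hΘ
  have hΘ0 : 0 ≤ Θ := hα.1.trans (le_max_left _ _)
  have hΘ1 : Θ < 1 := max_lt hα.2 hβ.2
  set η := min (ε / 8) ((1 - Θ) / 8) with hη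
  have hη0 : 0 < η := lt_min (by linarith) (by linarith)
  have hη1 : η ≤ ε / 8 := min_le_left _ _
  have hη2 : η ≤ (1 - Θ) / 8 := min_le_right _ _
  have hαΘ : α ≤ Θ := le_max_left _ _
  have hβΘ : β ≤ Θ := le_max_right _ _
  have hψ' := hψ (Θ + η - α) (by linarith)
  have hN' := hN (Θ + η - β) (by linarith)
  rw [show α + (Θ + η - α) = Θ + η by ring] at hψ'
  rw [show β + (Θ + η - β) = Θ + η by ring] at hN'
  simp only [BeurlingAux.psiP_eq] at hψ'
  simp only [BeurlingAux.NP_eq hmono hp0 htop] at hN'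
  have hw1 : ∀ q : ℕ × ℕ, 0 ≤ Real.log (p q.1) := fun q => Real.log_nonneg (hp q.1).le
  obtain ⟨C₁, hC₁, h1⟩ := BeurlingAux.unif_bound (c := 1) (κ := Θ + η)
    (BeurlingAux.cnt_mono hw1 (BeurlingAux.pp_fin hmono hp0 htop))
    (fun x => finsum_nonneg fun q => finsum_nonneg fun _ => hw1 q) (by linarith)
    (by simpa only [one_mul] using hψ')
  obtain ⟨C₂, hC₂, h2⟩ := BeurlingAux.unif_bound
    (BeurlingAux.cnt_mono (fun _ => zero_le_one) (BeurlingAux.gi_fin hmono hp0 htop))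
    (fun x => finsum_nonneg fun q => finsum_nonneg fun _ => zero_le_one) (by linarith) hN'
  obtain ⟨K, hK⟩ := BeurlingAux.main_bound hmono hp0 htop (κ := Θ + η) (η := η) (by linarith) hη0
    (by linarith) (by linarith) hρ hC₁ hC₂ h1 h2
  refine IsBigO.of_bound (max K 0) ?_
  filter_upwards [eventually_ge_atTop 1] with x hx
  have hx0 : (0:ℝ) < x := by linarith
  rw [Real.norm_eq_abs, Real.norm_of_nonneg (Real.rpow_nonneg hx0.le _)]
  calc |MP p x| ≤ K * x ^ (Θ + η + 5 * η) := hK x hx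
    _ ≤ max K 0 * x ^ (Θ + ε) := by
      refine mul_le_mul (le_max_left _ _) (Real.rpow_le_rpow_of_exponent_le hx (by linarith))
        (Real.rpow_nonneg hx0.le _) (le_max_right _ _)
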